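/- arXiv:1805.11338 — 5 statements merged into one kernel-verified Lean document; each statement's English description precedes it below -/
import Mathlib

section
/- Let g be a finite-dimensional simple Lie algebra over an algebraically closed field K of characteristic 0 and let c ∈ K, c ≠ 0. The scalar map c·id_g : g → g, x ↦ c·x, is a local automorphism of g if and only if c = 1 or c = −1. -/
/-- A linear map `φ : L → L` is a *local automorphism* of the Lie algebra `L` if for
every `x ∈ L` there exists a Lie algebra automorphism `e` of `L` with `φ x = e x`. -/
def IsLocalAutomorphism (K L : Type*) [Field K] [LieRing L] [LieAlgebra K L]
    (φ : L →ₗ[K] L) : Prop :=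
  ∀ x : L, ∃ e : L ≃ₗ⁅K⁆ L, φ x = e x

section

open LieAlgebra LieModule

namespace LieAlgebra.IsKilling

variable {K L : Type*} [Field K] [CharZero K] [LieRing L] [LieAlgebra K L] [FiniteDimensional K L]
  [IsKilling K L] {H : LieSubalgebra K L} [H.IsCartanSubalgebra] [IsTriangularizable K H L]

theorem exists_lie_eq_of_mem_rootSpace {α β γ : Weight K H L} (hβ : β.IsNonZero)
    (hγ : γ.IsNonZero) (h : (γ : H → K) = β + α) {y : L} (hy : y ∈ rootSpace H γ) :
    ∃ e ∈ rootSpace H β, ∃ x ∈ rootSpace H α, ⁅e, x⁆ = y := by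
  obtain ⟨z, hz, z_ne⟩ := (chainTop β γ).exists_ne_zero
  obtain ⟨h', e, f, t, he, hf⟩ := exists_isSl2Triple_of_weight_isNonZero hβ
  obtain rfl := t.h_eq_coroot hβ he hf
  have prim : t.HasPrimitiveVectorWith z (chainLength β γ : K) :=
    have := lie_mem_genWeightSpace_of_mem_genWeightSpace he hz
    ⟨z_ne, (chainLength_smul _ _ hz).symm, by rwa [genWeightSpace_add_chainTop _ _ hβ] at this⟩
  set n := chainTopCoeff β γ
  have hbot : (1 : ℤ) ≤ chainBotCoeff β γ := by
    refine le_chainBotCoeff_of_rootSpace_ne_top β γ hβ 1 ?_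
    rw [h]
    simpa using α.genWeightSpace_ne_bot
  have hlen := chainBotCoeff_add_chainTopCoeff β γ
  have hn : n < chainLength β γ := by omega
  have hm (k : ℕ) := toEnd_pow_apply_mem hf hz k
  have h0 := prim.lie_e_pow_succ_toEnd_f n
  have hne := prim.pow_toEnd_f_ne_zero_of_eq_nat rfl hn.le
  have hwn : n • (-β : H → K) + chainTop β γ = γ := by
    rw [coe_chainTop]; ext x; simp [n]
  have hwa : (n + 1) • (-β : H → K) + chainTop β γ = α := by
    rw [add_smul, add_right_comm, hwn, h]; ext x; simp
  have h1 := hm n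
  have h2 := hm (n + 1)
  rw [hwn] at h1
  rw [hwa] at h2
  obtain ⟨k, hk⟩ := (finrank_eq_one_iff_of_nonzero' (⟨_, h1⟩ : rootSpace H γ)
      (by simpa using hne)).mp
      (finrank_rootSpace_eq_one _ hγ) ⟨y, hy⟩
  replace hk := congr_arg Subtype.val hk
  simp only [LieSubmodule.coe_smul] at hk
  have hc : ((n : K) + 1) * (chainLength β γ - n) ≠ 0 := by
    refine mul_ne_zero (by exact_mod_cast n.succ_ne_zero) (sub_ne_zero.mpr ?_)
    exact_mod_cast hn.ne'
  refine ⟨e, he, (k / (((n : K) + 1) * (chainLength β γ - n))) • _, SMulMemClass.smul_mem _ h2, ?_⟩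
  rw [lie_smul, h0, smul_smul, div_mul_cancel₀ _ hc, hk]

theorem rootSpace_le_of_base (b : (rootSystem H).Base) (S : LieSubalgebra K L)
    (hS : ∀ i ∈ b.support, (rootSpace H i.1).toSubmodule ≤ S.toSubmodule ∧
      (rootSpace H (-i.1 : Weight K H L)).toSubmodule ≤ S.toSubmodule) (i : H.root) :
    (rootSpace H i.1).toSubmodule ≤ S.toSubmodule ∧
      (rootSpace H (-i.1 : Weight K H L)).toSubmodule ≤ S.toSubmodule := by
  have hnz (i : H.root) : i.1.IsNonZero := LieSubalgebra.isNonZero_coe_root i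
  induction i using b.induction_add with
  | h₀ i hi =>
    have : ((rootSystem H).reflectionPerm i i).1 = -i.1 := by
      have := (rootSystem H).root_reflectionPerm i i
      rw [RootPairing.reflection_apply_self] at this
      ext x
      rw [rootSystem_root_apply, rootSystem_root_apply] at this
      exact LinearMap.congr_fun this x
    rw [this, neg_neg]
    exact hi.symm
  | h₁ i hi => exact hS i hi
  | h₂ i j k hk hi hj =>
    have hk' : (k.1 : H → K) = j.1 + i.1 := by
      ext x
      simpa [add_comm] using LinearMap.congr_fun hk x
    constructor
    · intro y hy
      obtain ⟨e, he, x, hx, rfl⟩ := exists_lie_eq_of_mem_rootSpace (hnz j) (hnz k) hk' hy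
      exact S.lie_mem ((hS j hj).1 he) (hi.1 hx)
    · intro y hy
      obtain ⟨e, he, x, hx, rfl⟩ := exists_lie_eq_of_mem_rootSpace (α := -i.1) (β := -j.1)
        (γ := -k.1) (by simpa using hnz j) (by simpa using hnz k)
        (by simp [hk', add_comm]) hy
      exact S.lie_mem ((hS j hj).2 he) (hi.2 hx)

variable (H) in
theorem nonempty_basis : ∃ b : (rootSystem H).Base, Nonempty (LieAlgebra.Basis b.support H) := by
  classical
  obtain ⟨b⟩ := (rootSystem H).nonempty_base
  have hnz (i : H.root) : i.1.IsNonZero := LieSubalgebra.isNonZero_coe_root i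
  choose h e f t he hf using fun i : b.support ↦ exists_isSl2Triple_of_weight_isNonZero (hnz i.1)
  have hco (i : b.support) : h i = coroot i.1.1 := (t i).h_eq_coroot (hnz i.1) (he i) (hf i)
  have hspan : Submodule.span K (Set.range h) = H.toSubmodule := by
    have h1 : Set.range h = H.subtype '' ((rootSystem H).coroot '' b.support) := by
      ext x
      simp [hco]
    rw [h1]
    change Submodule.span K (H.toSubmodule.subtype '' _) = _
    rw [← Submodule.map_span, b.span_coroot_support]
    have := RootPairing.IsRootSystem.span_coroot_eq_top (P := rootSystem H)
    rw [RootPairing.corootSpan, this]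
    simp
  have hA (i j : b.support) : ((b.cartanMatrix i j : ℤ) : K) = i.1.1 (coroot j.1.1) := by
    have := b.algebraMap_cartanMatrixIn_apply ℤ i j
    simpa using this
  have hhh (i j : b.support) : ⁅h i, h j⁆ = 0 := by
    rw [hco, hco]
    exact congr_arg Subtype.val (trivial_lie_zero H H (coroot i.1.1) (coroot j.1.1))
  have hS : LieSubalgebra.lieSpan K L (Set.range e ∪ Set.range f) = ⊤ := by
    set S := LieSubalgebra.lieSpan K L (Set.range e ∪ Set.range f)
    have he' (i) : e i ∈ S := LieSubalgebra.subset_lieSpan (Or.inl ⟨i, rfl⟩)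
    have hf' (i) : f i ∈ S := LieSubalgebra.subset_lieSpan (Or.inr ⟨i, rfl⟩)
    have key (W : Weight K H L) (hW : W.IsNonZero) (z : L) (hz : z ∈ rootSpace H W) (hz0 : z ≠ 0)
        (hzS : z ∈ S) : (rootSpace H W).toSubmodule ≤ S.toSubmodule := by
      intro y hy
      obtain ⟨k, hk⟩ := (finrank_eq_one_iff_of_nonzero' (⟨z, hz⟩ : rootSpace H W)
        (by simpa using hz0)).mp (finrank_rootSpace_eq_one _ hW) ⟨y, hy⟩
      replace hk := congr_arg Subtype.val hk
      simp only [LieSubmodule.coe_smul] at hk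
      rw [← hk]
      exact S.smul_mem k hzS
    have hroot := rootSpace_le_of_base b S fun i hi ↦
      ⟨key _ (hnz i) _ (he ⟨i, hi⟩) (t ⟨i, hi⟩).e_ne_zero (he' _),
        key (-i.1) (by simpa using hnz i) _ (by simpa using hf ⟨i, hi⟩)
          (t ⟨i, hi⟩).f_ne_zero (hf' _)⟩
    have hH : H.toSubmodule ≤ S.toSubmodule := by
      rw [← hspan, Submodule.span_le]
      rintro - ⟨i, rfl⟩
      rw [← (t i).lie_e_f]
      exact S.lie_mem (he' i) (hf' i)
    rw [← LieSubalgebra.toSubmodule_inj, LieSubalgebra.top_toSubmodule, _root_.eq_top_iff]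
    have htop := iSup_genWeightSpace_eq_top' K H L
    rw [← LieSubmodule.toSubmodule_inj, LieSubmodule.iSup_toSubmodule] at htop
    rw [← LieSubmodule.top_toSubmodule (R := K) (L := H), ← htop, iSup_le_iff]
    intro W
    by_cases hW : W.IsZero
    · have h0 : rootSpace H (0 : H → K) = H.toLieSubmodule := rootSpace_zero_eq K L H
      rw [hW.eq]
      exact (congr_arg LieSubmodule.toSubmodule h0).trans_le hH
    · exact (hroot ⟨W, by simpa using hW⟩).1
  refine ⟨b, ⟨{
    A := b.cartanMatrix
    h := h
    e := e
    f := f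
    cartan_eq_lieSpan := ?_
    span_ef := hS
    linInd := ?_
    nondegen := b.cartanMatrix_nondegenerate
    sl2 := t
    lie_h_h := hhh
    lie_h_e := fun i j ↦ ?_
    lie_h_f := fun i j ↦ ?_
    lie_e_f_ne := fun i j hij ↦ ?_ }⟩⟩
  · rw [← LieSubalgebra.toSubmodule_inj, ← hspan,
      LieSubalgebra.coe_lieSpan_eq_span_of_forall_lie_eq_zero]
    rintro - ⟨i, rfl⟩ - ⟨j, rfl⟩
    exact hhh i j
  · have := b.linearIndepOn_coroot
    have h2 := LinearIndependent.map' this H.toSubmodule.subtype (Submodule.ker_subtype _)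
    rw [show h = _ from funext hco]
    exact h2
  · have := lie_eq_smul_of_mem_rootSpace (he i) (coroot j.1.1)
    rw [← hA, Int.cast_smul_eq_zsmul] at this
    rw [hco]
    exact this
  · have := lie_eq_smul_of_mem_rootSpace (hf i) (coroot j.1.1)
    rw [Pi.neg_apply, ← hA, ← Int.cast_neg, Int.cast_smul_eq_zsmul] at this
    rw [hco]
    exact this
  · by_contra hne
    have hmem : ⁅e i, f j⁆ ∈ rootSpace H (i.1.1 + -j.1.1 : H → K) :=
      lie_mem_genWeightSpace_of_mem_genWeightSpace (he i) (hf j)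
    have hbot : rootSpace H (i.1.1 + -j.1.1 : H → K) ≠ ⊥ := by
      intro h0
      rw [h0] at hmem
      exact hne (by simpa using hmem)
    have h3 := b.sub_notMem_range_root i.2 j.2
    refine h3 ?_
    have hw : (⟨_, hbot⟩ : Weight K H L).IsNonZero := by
      intro h0
      have h0' : (i.1.1 + -j.1.1 : H → K) = 0 := h0.eq
      apply hij
      ext x
      have := congr_fun h0' x
      simpa [add_neg_eq_zero] using this
    refine ⟨⟨⟨_, hbot⟩, by simpa using hw⟩, ?_⟩
    ext x
    simp [sub_eq_add_neg]

end LieAlgebra.IsKilling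

end

section

open LieAlgebra

theorem LieEquiv.symm_trans_apply_of_eq {K X Y Z : Type*} [CommRing K] [LieRing X] [LieRing Y]
    [LieRing Z]
    [LieAlgebra K X] [LieAlgebra K Y] [LieAlgebra K Z] (a : X ≃ₗ⁅K⁆ Y) (b : X ≃ₗ⁅K⁆ Z)
    {z : X} {x : Y} {y : Z} (hx : a z = x) (hy : b z = y) : (a.symm.trans b) x = y := by
  rw [LieEquiv.trans_apply, ← hx, LieEquiv.symm_apply_apply, hy]

theorem LieAlgebra.Basis.equivOfReindex_symm_h {ι K L : Type*} [Finite ι] [Field K] [CharZero K]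
    [LieRing L] [LieAlgebra K L] [FiniteDimensional K L] [IsSimple K L] {H : LieSubalgebra K L} (b :
    LieAlgebra.Basis ι H)
    (i : ι) :
    LieAlgebra.Basis.equivOfReindex (Equiv.refl ι) b b.symm rfl (b.h i) = - b.h i := by
  unfold LieAlgebra.Basis.equivOfReindex
  refine LieEquiv.symm_trans_apply_of_eq _ _
    (z := ⟨(b.h i, - b.h i), LieSubalgebra.subset_lieSpan (Or.inl (Or.inl ⟨i, rfl⟩))⟩) rfl rfl

theorem LieAlgebra.Basis.exists_lieEquiv_eq_neg {ι K L : Type*} [Finite ι] [Field K] [CharZero K]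
    [LieRing L] [LieAlgebra K L] [FiniteDimensional K L] [IsSimple K L] {H : LieSubalgebra K L} (b :
    LieAlgebra.Basis ι H) :
    ∃ θ : L ≃ₗ⁅K⁆ L, ∀ x ∈ H, θ x = -x := by
  refine ⟨LieAlgebra.Basis.equivOfReindex (Equiv.refl ι) b b.symm rfl, fun x hx ↦ ?_⟩
  replace hx : x ∈ Submodule.span K (Set.range b.h) := b.coe_cartan_eq_span ▸ hx
  induction hx using Submodule.span_induction with
  | mem x hx => obtain ⟨i, rfl⟩ := hx; exact b.equivOfReindex_symm_h i
  | zero => simp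
  | add x y _ _ hx hy => rw [map_add, hx, hy, neg_add]
  | smul t x _ hx => rw [map_smul, hx, smul_neg]

end

namespace LieAlgebra

open Module

variable {K L : Type*} [Field K] [IsAlgClosed K] [LieRing L] [LieAlgebra K L]
  [FiniteDimensional K L]

theorem exists_lieDerivation_eq_of_isNilpotent_sub {x : L} {S : End K L} (hS : S.IsSemisimple)
    (hxS : Commute (ad K L x : End K L) S) (hn : IsNilpotent ((ad K L x : End K L) - S)) :
    ∃ d : LieDerivation K L L, d.toLinearMap = S := by
  have key {a : K} {y : L} (hy : y ∈ (ad K L x : End K L).maxGenEigenspace a) : S y = a • y :=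
    Module.End.apply_eq_of_mem_of_comm_of_isFinitelySemisimple_of_isNil hy hxS
      hS.isFinitelySemisimple hn
  refine ⟨⟨S, fun y z ↦ ?_⟩, rfl⟩
  have htop := Module.End.iSup_maxGenEigenspace_eq_top (ad K L x : End K L)
  have hy : y ∈ ⨆ μ, (ad K L x : End K L).maxGenEigenspace μ := htop ▸ Submodule.mem_top
  have hz : z ∈ ⨆ μ, (ad K L x : End K L).maxGenEigenspace μ := htop ▸ Submodule.mem_top
  induction hy using Submodule.iSup_induction' with
  | zero => simp
  | add u v _ _ hu hv => simp [hu, hv]; abel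
  | mem a u hu =>
    induction hz using Submodule.iSup_induction' with
    | zero => simp
    | add u' v' _ _ hu' hv' => simp [hu', hv']; abel
    | mem b v hv =>
      rw [key hu, key hv, key (LieModule.lie_mem_maxGenEigenspace_toEnd hu hv)]
      simp [add_smul, ← lie_skew v u, -lie_skew, add_comm]

variable [CharZero K] [IsKilling K L]

variable (K) in
theorem exists_add_eq_isSemisimple_ad_isNilpotent_ad (x : L) :
    ∃ s n : L, s + n = x ∧ (ad K L s).IsSemisimple ∧ IsNilpotent (ad K L n) ∧
      ∀ (y : L) (μ : K), ⁅x, y⁆ = μ • y → ⁅s, y⁆ = μ • y := by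
  obtain ⟨N, hN, S, hS, hNn, hSs, hx⟩ := (ad K L x : End K L).exists_isNilpotent_isSemisimple
  have hxS : Commute (ad K L x : End K L) S := Algebra.commute_of_mem_adjoin_self hS
  have hn : IsNilpotent ((ad K L x : End K L) - S) := by rwa [hx, add_sub_cancel_right]
  obtain ⟨d, hd⟩ := exists_lieDerivation_eq_of_isNilpotent_sub hSs hxS hn
  obtain ⟨s, hs⟩ := LieDerivation.IsKilling.exists_eq_ad d
  have hs' : (ad K L s : End K L) = S := by
    rw [← hd, ← hs]
    ext z
    simp
  refine ⟨s, x - s, by simp, by rwa [hs'], by rwa [map_sub, hs'], fun y μ hy ↦ ?_⟩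
  have : S y = μ • y :=
    Module.End.apply_eq_of_mem_of_comm_of_isFinitelySemisimple_of_isNil (k := 1)
      (Module.End.mem_eigenspace_iff.mpr hy) hxS hSs.isFinitelySemisimple hn
  rwa [← hs'] at this

end LieAlgebra

section

open LieAlgebra

theorem Module.End.IsSemisimple.apply_eq_zero_of_apply_apply {K V : Type*} [Field K]
    [AddCommGroup V]
    [Module K V] [FiniteDimensional K V] {f : Module.End K V} (hf : f.IsSemisimple) {v : V}
    (hv : f (f v) = 0) : f v = 0 := by
  have h := hf.isFinitelySemisimple.genEigenspace_eq_eigenspace 0 (k := 2) (by norm_num)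
  have hm : v ∈ f.genEigenspace 0 2 := by
    have := Module.End.mem_genEigenspace_nat (f := f) (μ := 0) (k := 2) (x := v)
    simp at this
    refine this.mpr ?_
    simpa [pow_two] using hv
  rw [h, Module.End.mem_eigenspace_iff] at hm
  simpa using hm

namespace LieAlgebra

variable {K L : Type*} [Field K] [LieRing L] [LieAlgebra K L]

theorem exists_isCartanSubalgebra_of_isSemisimple_ad [Infinite K] [FiniteDimensional K L] {s h : L}
   (hs : (ad K L s).IsSemisimple) (hh : (ad K L h).IsSemisimple) (hsh : ⁅s, h⁆ = 0) :
   ∃ H : LieSubalgebra K L, H.IsCartanSubalgebra ∧ s ∈ H ∧ h ∈ H := by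
  let Z : LieSubalgebra K L :=
    { (LinearMap.ker (ad K L s) ⊓ LinearMap.ker (ad K L h) : Submodule K L) with
      lie_mem' := by
        rintro x y ⟨hx1, hx2⟩ ⟨hy1, hy2⟩
        simp only [SetLike.mem_coe, LinearMap.mem_ker, ad_apply] at *
        constructor <;> simp only [SetLike.mem_coe, LinearMap.mem_ker, ad_apply, leibniz_lie, *,
          zero_lie, lie_zero, add_zero] }
  have mem_Z (y : L) : y ∈ Z ↔ ⁅s, y⁆ = 0 ∧ ⁅h, y⁆ = 0 := Iff.rfl
  have hhs : ⁅h, s⁆ = 0 := by rw [← lie_skew, hsh, neg_zero]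
  obtain ⟨x, hC⟩ := exists_isCartanSubalgebra_engel K Z
  set C := LieSubalgebra.engel K x
  have hnorm := hC.self_normalizing
  have hcen (t : Z) (ht : ∀ y : Z, ⁅t, y⁆ = 0) : t ∈ C := by
    rw [← hnorm, LieSubalgebra.mem_normalizer_iff]
    intro y _
    rw [ht]
    exact C.zero_mem
  have hsC := hcen ⟨s, by simp [mem_Z, hhs]⟩ fun y ↦ Subtype.ext ((mem_Z _).mp y.2).1
  have hhC := hcen ⟨h, by simp [mem_Z, hsh]⟩ fun y ↦ Subtype.ext ((mem_Z _).mp y.2).2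
  have memC {y : L} (hy : y ∈ C.map Z.incl) : ∃ c : Z, c ∈ C ∧ (c : L) = y := hy
  refine ⟨C.map Z.incl, ⟨?_, ?_⟩, ⟨_, hsC, rfl⟩, ⟨_, hhC, rfl⟩⟩
  · have : LieRing.IsNilpotent C := hC.nilpotent
    exact (LieSubalgebra.equivMapOfInjective (K := C) (f := Z.incl)
      Subtype.val_injective).nilpotent_iff_equiv_nilpotent.mp this
  · refine le_antisymm (fun y hy ↦ ?_) (LieSubalgebra.le_normalizer _)
    rw [LieSubalgebra.mem_normalizer_iff'] at hy
    have h1 : ⁅s, y⁆ = 0 := by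
      obtain ⟨c, -, hc⟩ := memC (hy s ⟨_, hsC, rfl⟩)
      refine hs.apply_eq_zero_of_apply_apply ?_
      rw [ad_apply, ad_apply, ← hc]
      exact ((mem_Z _).mp c.2).1
    have h2 : ⁅h, y⁆ = 0 := by
      obtain ⟨c, -, hc⟩ := memC (hy h ⟨_, hhC, rfl⟩)
      refine hh.apply_eq_zero_of_apply_apply ?_
      rw [ad_apply, ad_apply, ← hc]
      exact ((mem_Z _).mp c.2).2
    refine ⟨⟨y, h1, h2⟩, ?_, rfl⟩
    change _ ∈ C
    rw [← hnorm, LieSubalgebra.mem_normalizer_iff']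
    intro d hd
    obtain ⟨c, hc, hc'⟩ := memC (hy d ⟨_, hd, rfl⟩)
    convert hc
    exact Subtype.ext hc'.symm

end LieAlgebra

end

namespace Module.End

variable {K V : Type*} [Field K] [CharZero K] [AddCommGroup V] [Module K V]

theorem isNilpotent_of_commute_commutator {A B C : End K V} (hC : A * B - B * A = C)
    (hAC : Commute A C) (hA : IsNilpotent A) : IsNilpotent C := by
  let δ : End K V →ₗ[K] End K V := LinearMap.mulLeft K A - LinearMap.mulRight K A
  have hδ (X) : δ X = A * X - X * A := by simp [δ]
  have hmul (X Y) : δ (X * Y) = δ X * Y + X * δ Y := by simp only [hδ]; noncomm_ring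
  have hδC : δ C = 0 := by rw [hδ, hAC.eq, sub_self]
  have leib (X : End K V) (m : ℕ) :
      (δ ^ (m + 1)) (X * B) = (δ ^ (m + 1)) X * B + (m + 1) • ((δ ^ m) X * C) := by
    induction m with
    | zero => simp [hmul, hδ B, hC]
    | succ m ih =>
      have hs : δ ((δ ^ m) X) = (δ ^ (m + 1)) X := by rw [pow_succ', mul_apply]
      rw [pow_succ', mul_apply, ih, map_add, map_nsmul, hmul, hmul, hδC, hδ B, hC, hs, mul_zero,
        add_zero, add_assoc, ← succ_nsmul', mul_apply]
  have key (k : ℕ) : (δ ^ k) (B ^ k) = (k.factorial : K) • C ^ k := by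
    induction k with
    | zero => simp
    | succ k ih =>
      rw [pow_succ B, leib, pow_succ' δ, mul_apply, ih, map_smul]
      have : δ (C ^ k) = 0 := by rw [hδ, (hAC.pow_right k).eq, sub_self]
      rw [this, smul_zero, zero_mul, zero_add, ← Nat.cast_smul_eq_nsmul K, smul_mul_assoc,
        smul_smul, ← pow_succ,
        Nat.factorial_succ, Nat.cast_mul]
  have hδn : IsNilpotent δ := by
    apply Commute.isNilpotent_sub (LinearMap.commute_mulLeft_right (R := K) A A)
    · rwa [LinearMap.isNilpotent_mulLeft_iff]
    · rwa [LinearMap.isNilpotent_mulRight_iff]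
  obtain ⟨k, hk⟩ := hδn
  refine ⟨k, ?_⟩
  have := key k
  rw [hk, LinearMap.zero_apply, eq_comm, smul_eq_zero] at this
  exact this.resolve_left (by exact_mod_cast k.factorial_ne_zero)

theorem trace_mul_eq_zero_of_commute_commutator [IsAlgClosed K] [FiniteDimensional K V]
    {A B C : End K V} (hC : A * B - B * A = C)
    (hAC : Commute A C) (hA : IsNilpotent A) : LinearMap.trace K V (A * B) = 0 := by
  have hCn := isNilpotent_of_commute_commutator hC hAC hA
  have hcomm (p : ℕ) : A ^ (p + 1) * B - B * A ^ (p + 1) = (p + 1) • (C * A ^ p) := by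
    induction p with
    | zero => simp [hC]
    | succ p ih =>
      have : A ^ (p + 2) * B - B * A ^ (p + 2) =
          A * (A ^ (p + 1) * B - B * A ^ (p + 1)) + (A * B - B * A) * A ^ (p + 1) := by
        rw [pow_succ' A (p + 1)]; noncomm_ring
      rw [this, ih, hC, mul_smul_comm, ← mul_assoc, hAC.eq, mul_assoc, ← pow_succ',
        succ_nsmul _ (p + 1)]
  rw [trace_eq_sum_roots_charpoly_of_splits (IsAlgClosed.splits _)]
  refine Multiset.sum_eq_zero fun μ hμ ↦ ?_
  have hev : (A * B).HasEigenvalue μ := by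
    rw [hasEigenvalue_iff_isRoot_charpoly]
    exact (Polynomial.mem_roots'.mp hμ).2
  obtain ⟨x, hx⟩ := hev.exists_hasEigenvector
  by_contra hμ0
  have hstep (p : ℕ) (hp : (A ^ (p + 1)) x = 0) : (A ^ p) x = 0 := by
    have h1 := LinearMap.congr_fun (hcomm p) x
    have h2 : (A ^ (p + 1) * B) x = μ • (A ^ p) x := by
      rw [pow_succ, mul_assoc, mul_apply, hx.apply_eq_smul, map_smul]
    rw [LinearMap.sub_apply, h2, mul_apply, hp, map_zero, sub_zero] at h1
    obtain ⟨k, hk⟩ := hCn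
    have h3 (k : ℕ) : μ ^ k • (A ^ p) x = ((p + 1 : K) ^ k) • (C ^ k) ((A ^ p) x) := by
      induction k with
      | zero => simp
      | succ k ih =>
        rw [pow_succ', mul_smul, ih, smul_comm, ← map_smul, h1, LinearMap.smul_apply, map_nsmul,
          mul_apply,
          ← mul_apply, ← pow_succ, ← Nat.cast_smul_eq_nsmul K, smul_smul]
        simp [pow_succ]
    have := h3 k
    rw [hk, LinearMap.zero_apply, smul_zero, smul_eq_zero] at this
    exact this.resolve_left (pow_ne_zero _ hμ0)
  have hall (p : ℕ) (hp : (A ^ p) x = 0) : x = 0 := by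
    induction p with
    | zero => simpa using hp
    | succ p ih => exact ih (hstep p hp)
  obtain ⟨k, hk⟩ := hA
  exact hx.2 (hall k (by simp [hk]))

theorem exists_eq_natCast_of_mem_range_pow {A B C : End K V} (hC : A * B - B * A = C)
    (hCA : C * A - A * C = (2 : K) • A) (hA : IsNilpotent A) {v : V} (hv : v ≠ 0) (hAv : A v = 0)
    {μ : K} (hCv : C v = μ • v) {k : ℕ} (hk : v ∈ LinearMap.range (A ^ k)) :
    ∃ j : ℕ, k ≤ j ∧ μ = j := by
  have hCA' : C * A = A * C + (2 : K) • A := by rw [← hCA]; abel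
  have hpow (p : ℕ) : C * A ^ p = A ^ p * C + (2 * p : K) • A ^ p := by
    induction p with
    | zero => simp
    | succ p ih =>
      rw [pow_succ, ← mul_assoc, ih, add_mul, mul_assoc, hCA', smul_mul_assoc, mul_add,
        mul_smul_comm, ← mul_assoc,
        add_assoc, ← add_smul]
      congr 2
      push_cast; ring
  have hcomm (p : ℕ) : A ^ (p + 1) * B - B * A ^ (p + 1) =
      (p + 1 : K) • (C * A ^ p - (p : K) • A ^ p) := by
    induction p with
    | zero => simp [hC]
    | succ p ih =>
      have : A ^ (p + 2) * B - B * A ^ (p + 2) =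
          A * (A ^ (p + 1) * B - B * A ^ (p + 1)) + (A * B - B * A) * A ^ (p + 1) := by
        rw [pow_succ' A (p + 1)]; noncomm_ring
      have h2 : A * C = C * A - (2 : K) • A := by rw [← hCA]; abel
      rw [this, ih, hC, mul_smul_comm, mul_sub, ← mul_assoc, h2, sub_mul, mul_smul_comm, mul_assoc,
        smul_mul_assoc, ← pow_succ']
      push_cast
      module
  obtain ⟨m, hm⟩ := hA
  have hex : ∃ j, v ∉ LinearMap.range (A ^ j) := ⟨m, by simpa [hm] using hv⟩
  classical
  have hfind := Nat.find_spec hex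
  have hmin (j) (hj : j < Nat.find hex) : v ∈ LinearMap.range (A ^ j) := by
    simpa using Nat.find_min hex hj
  obtain ⟨j, hj⟩ : ∃ j, Nat.find hex = j + 1 := Nat.exists_eq_succ_of_ne_zero fun h0 ↦ by
    rw [h0] at hfind; simp at hfind
  rw [hj] at hfind hmin
  have hkj : k ≤ j := by
    by_contra! hlt
    obtain ⟨w, rfl⟩ := hk
    exact hfind ⟨(A ^ (k - (j + 1))) w, by rw [← mul_apply, ← pow_add]; congr 2; omega⟩
  refine ⟨j, hkj, ?_⟩
  obtain ⟨w, hw⟩ := hmin j (Nat.lt_succ_self j)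
  have h1 := LinearMap.congr_fun (hcomm j) w
  have h0 : (A ^ (j + 1)) w = 0 := by rw [pow_succ', mul_apply, hw, hAv]
  simp only [LinearMap.sub_apply, mul_apply, LinearMap.smul_apply, h0, map_zero, sub_zero, hw, hCv]
    at h1
  rw [← sub_smul, smul_smul] at h1
  by_contra hne
  have hne' : ((j + 1 : K) * (μ - j)) ≠ 0 :=
    mul_ne_zero (Nat.cast_add_one_ne_zero j) (sub_ne_zero.mpr hne)
  exact hfind ⟨((j + 1 : K) * (μ - j))⁻¹ • B w, by rw [map_smul, h1, inv_smul_smul₀ hne']⟩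

end Module.End

namespace LieAlgebra

open Module

variable {K L : Type*} [Field K] [LieRing L] [LieAlgebra K L]
  [FiniteDimensional K L]

theorem exists_add_lie_eq_of_isSemisimple_ad {s : L} (hs : (ad K L s).IsSemisimple) (y : L) :
    ∃ z u, ⁅s, z⁆ = 0 ∧ z + ⁅s, u⁆ = y := by
  have h : LinearMap.ker (ad K L s : End K L) ⊔ LinearMap.range (ad K L s : End K L) = ⊤ := by
    apply Submodule.eq_top_of_disjoint
    · rw [add_comm, LinearMap.finrank_range_add_finrank_ker]
    · rw [Submodule.disjoint_def]
      rintro _ hx ⟨u, rfl⟩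
      exact hs.apply_eq_zero_of_apply_apply hx
  obtain ⟨z, hz, _, ⟨u, rfl⟩, hzu⟩ := Submodule.mem_sup.mp (h ▸ Submodule.mem_top (x := y))
  exact ⟨z, u, hz, hzu⟩

variable [CharZero K]

theorem isNilpotent_ad_of_lie_eq_smul {h f : L} {μ : K} (hμ : μ ≠ 0) (hf : ⁅h, f⁆ = μ • f) :
    IsNilpotent (ad K L f) := by
  let A : End K L := ad K L f
  let C : End K L := ad K L h
  have hCA : C * A - A * C = μ • A := by
    ext x
    simp [A, C, ← smul_lie, ← hf]
  let δ : End K (End K L) := LinearMap.mulLeft K C - LinearMap.mulRight K C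
  have hδ (k : ℕ) : δ (A ^ k) = (k * μ : K) • A ^ k := by
    induction k with
    | zero => simp [δ]
    | succ k ih =>
      have h1 : δ (A ^ (k + 1)) = δ (A ^ k) * A + A ^ k * (C * A - A * C) := by
        simp only [δ, LinearMap.sub_apply, LinearMap.mulLeft_apply, LinearMap.mulRight_apply,
          pow_succ]
        noncomm_ring
      rw [h1, ih, hCA, smul_mul_assoc, mul_smul_comm, ← pow_succ, ← add_smul]
      push_cast
      ring_nf
  by_contra hA
  have hinf : (Set.range fun k : ℕ ↦ (k * μ : K)).Infinite :=
    Set.infinite_range_of_injective fun i j hij ↦ by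
      simpa [hμ] using hij
  refine hinf (δ.finite_hasEigenvalue.subset ?_)
  rintro _ ⟨k, rfl⟩
  exact Module.End.hasEigenvalue_of_hasEigenvector
    ⟨Module.End.mem_eigenspace_iff.mpr (hδ k), fun h ↦ hA ⟨k, h⟩⟩

omit [FiniteDimensional K L] in
variable (K) in
theorem exists_lieEquiv_exp_ad {x : L} (hx : IsNilpotent (ad K L x)) :
    ∃ e : L ≃ₗ⁅K⁆ L, ∀ y, ⁅x, ⁅x, ⁅x, y⁆⁆⁆ = 0 → e y = y + ⁅x, y⁆ + (2 : K)⁻¹ • ⁅x, ⁅x, y⁆⁆ := by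
  let : Module ℚ L := Module.compHom L (algebraMap ℚ K)
  have hsmul (q : ℚ) (y : L) : q • y = (q : K) • y := rfl
  let : LieAlgebra ℚ L := { lie_smul := fun q y z ↦ by simp [hsmul] }
  have hx' : IsNilpotent (LieDerivation.ad K L x).toLinearMap := by
    convert hx
    ext; simp
  refine ⟨(LieDerivation.ad K L x).exp hx', fun y hy ↦ ?_⟩
  obtain ⟨k, hk⟩ := hx
  have hk' : (LieDerivation.ad K L x).toLinearMap ^ (k + 3) = 0 := by
    have : (LieDerivation.ad K L x).toLinearMap = ad K L x := by ext; simp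
    rw [this, pow_add, hk, zero_mul]
  rw [LieDerivation.exp_map_apply, IsNilpotent.exp_eq_sum hk']
  rw [add_comm k 3, Finset.sum_range_add]
  simp [Finset.sum_range_succ, hsmul, pow_succ, LinearMap.sum_apply, add_comm 3, hy]

end LieAlgebra

namespace LieAlgebra

open Module

section

variable {K L : Type*} [Field K] [CharZero K] [LieRing L] [LieAlgebra K L]

theorem lie_ne_neg_two_smul_of_isNilpotent_ad {n h y v : L} (hn : IsNilpotent (ad K L n))
    (hy : ⁅n, y⁆ = h) (hhn : ⁅h, n⁆ = (2 : K) • n) (hnv : ⁅n, v⁆ = 0)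
    (hhv : ⁅h, v⁆ = (-2 : K) • v) : v = 0 := by
  by_contra hv
  obtain ⟨j, -, hj⟩ := Module.End.exists_eq_natCast_of_mem_range_pow (k := 0)
    (A := ad K L n) (B := ad K L y) (C := ad K L h) (by ext x; simp [← hy])
    (by ext x; simp [← smul_lie, ← hhn]) hn hv hnv hhv (by simp)
  have : ((j + 2 : ℕ) : K) = 0 := by push_cast; rw [← hj]; ring
  exact absurd (Nat.cast_eq_zero.mp this) (by omega)

variable [IsAlgClosed K] [FiniteDimensional K L] [IsKilling K L]

theorem exists_lie_lie_eq_self {n : L} (hn : IsNilpotent (ad K L n)) : ∃ y : L, ⁅n,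
    ⁅n, y⁆⁆ = n := by
  let A : End K L := ad K L n
  by_contra! hcon
  have hnot : n ∉ LinearMap.range (A * A) := by
    rintro ⟨y, hy⟩
    exact hcon y hy
  obtain ⟨φ, hφn, hφ⟩ := Submodule.exists_le_ker_of_notMem hnot
  have hnd := LieAlgebra.IsKilling.killingForm_nondegenerate K L
  obtain ⟨z, hz⟩ := ((killingForm K L).toDual hnd).surjective φ
  have hz' (x : L) : killingForm K L z x = φ x := by rw [← hz]; rfl
  have hinv (x y : L) : killingForm K L ⁅n, x⁆ y = - killingForm K L x ⁅n, y⁆ := by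
    rw [← lie_skew n x, map_neg, LinearMap.neg_apply, LieModule.traceForm_apply_lie_apply]
  have hnnz : ⁅n, ⁅n, z⁆⁆ = 0 := by
    refine hnd.1 _ fun x ↦ ?_
    rw [hinv, hinv, neg_neg, hz']
    exact hφ ⟨x, rfl⟩
  apply hφn
  rw [← hz', LieModule.traceForm_comm, killingForm_apply_apply]
  refine Module.End.trace_mul_eq_zero_of_commute_commutator (C := ad K L ⁅n, z⁆) (by ext; simp)
    ?_ hn
  refine LinearMap.ext fun x ↦ ?_
  have := leibniz_lie n ⁅n, z⁆ x
  rwa [hnnz, zero_lie, zero_add] at this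

theorem exists_sl_two_triple_of_isNilpotent_ad {s n : L} (hs : (ad K L s).IsSemisimple)
    (hn : IsNilpotent (ad K L n)) (hsn : ⁅s, n⁆ = 0) :
    ∃ h f : L, ⁅s, h⁆ = 0 ∧ ⁅s, f⁆ = 0 ∧ ⁅h, n⁆ = (2 : K) • n ∧ ⁅h, f⁆ = (-2 : K) • f ∧ ⁅n,
    f⁆ = h := by
  have hcomm (x : L) : ⁅s, ⁅n, x⁆⁆ = ⁅n, ⁅s, x⁆⁆ := by rw [leibniz_lie, hsn, zero_lie, zero_add]
  have hproj {a b : L} (ha : ⁅s, a⁆ = 0) (h : a = ⁅s, b⁆) : a = 0 := by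
    subst h
    exact hs.apply_eq_zero_of_apply_apply ha
  obtain ⟨y₀, hy₀⟩ := exists_lie_lie_eq_self hn
  obtain ⟨y₁, u, hy₁, hyu⟩ := exists_add_lie_eq_of_isSemisimple_ad hs y₀
  have hny₁ : ⁅n, ⁅n, y₁⁆⁆ = n := by
    refine (sub_eq_zero.mp (hproj (b := ⁅n, ⁅n, u⁆⁆) ?_ ?_)).symm
    · simp [hcomm, hsn, hy₁]
    · rw [hcomm, hcomm, sub_eq_iff_eq_add', ← lie_add, ← lie_add, hyu, hy₀]
  set y : L := (-2 : K) • y₁ with hy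
  have hsy : ⁅s, y⁆ = 0 := by simp [hy, hy₁]
  obtain ⟨h, hh⟩ : ∃ h, ⁅n, y⁆ = h := ⟨_, rfl⟩
  have hsh : ⁅s, h⁆ = 0 := by rw [← hh, hcomm, hsy, lie_zero]
  have hhn : ⁅h, n⁆ = (2 : K) • n := by
    rw [← lie_skew, ← hh, hy, lie_smul, lie_smul, hny₁]
    module
  have hnh : ⁅n, h⁆ = (-2 : K) • n := by rw [← lie_skew, hhn]; module
  let N := LinearMap.ker (ad K L n : End K L)
  have hmap (v : L) (hv : v ∈ N) : ((ad K L h : End K L) + (2 : K) • 1) v ∈ N := by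
    have hv' : ⁅n, v⁆ = 0 := hv
    change ⁅n, ⁅h, v⁆ + (2 : K) • v⁆ = 0
    rw [lie_add, leibniz_lie, hnh]
    simp [hv']
  let R : N →ₗ[K] N := LinearMap.restrict ((ad K L h : End K L) + (2 : K) • 1) hmap
  have hR : Function.Injective R := by
    rw [injective_iff_map_eq_zero]
    rintro ⟨v, hv⟩ hRv
    have h1 : ⁅h, v⁆ + (2 : K) • v = 0 := congrArg Subtype.val hRv
    ext
    refine lie_ne_neg_two_smul_of_isNilpotent_ad hn hh hhn hv ?_
    rw [eq_neg_of_add_eq_zero_left h1, neg_smul]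
  have hr : ⁅h, y⁆ + (2 : K) • y ∈ N := by
    change ⁅n, ⁅h, y⁆ + (2 : K) • y⁆ = 0
    rw [lie_add, leibniz_lie, hnh, hh, lie_self, add_zero, smul_lie, hh, lie_smul, hh]
    module
  obtain ⟨⟨w, hw⟩, hRw⟩ := (LinearMap.injective_iff_surjective.mp hR) ⟨_, hr⟩
  have h2 : ⁅h, w⁆ + (2 : K) • w = ⁅h, y⁆ + (2 : K) • y := congrArg Subtype.val hRw
  have hw' : ⁅n, w⁆ = 0 := hw
  obtain ⟨f, u', hf, hfu⟩ := exists_add_lie_eq_of_isSemisimple_ad hs (y - w)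
  have hcomm' (x : L) : ⁅s, ⁅h, x⁆⁆ = ⁅h, ⁅s, x⁆⁆ := by rw [leibniz_lie, hsh, zero_lie, zero_add]
  refine ⟨h, f, hsh, hf, hhn, ?_, ?_⟩
  · refine sub_eq_zero.mp (hproj (b := (-2 : K) • u' - ⁅h, u'⁆) ?_ ?_)
    · simp [hcomm', hf]
    · have h3 : ⁅h, y - w⁆ = (-2 : K) • (y - w) := by
        rw [lie_sub, eq_sub_of_add_eq h2]
        module
      rw [lie_sub, hcomm', lie_smul, eq_sub_of_add_eq hfu, lie_sub, h3]
      module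
  · refine sub_eq_zero.mp (hproj (b := -⁅n, u'⁆) ?_ ?_)
    · simp [hcomm, hf, hsh]
    · rw [eq_sub_of_add_eq hfu, lie_sub, lie_sub, hh, hw', lie_neg, hcomm]
      abel

omit [IsAlgClosed K] [IsKilling K L] in
theorem exists_lieEquiv_lie_eq_two_smul {h n f : L} (hhn : ⁅h, n⁆ = (2 : K) • n)
    (hhf : ⁅h, f⁆ = (-2 : K) • f) (hnf : ⁅n, f⁆ = h) :
    ∃ w : L ≃ₗ⁅K⁆ L, w h = -h ∧ ∀ s, ⁅s, n⁆ = 0 → ⁅s, f⁆ = 0 → w s = s := by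
  obtain ⟨E, hE⟩ := exists_lieEquiv_exp_ad K (isNilpotent_ad_of_lie_eq_smul two_ne_zero hhn)
  obtain ⟨F, hF⟩ := exists_lieEquiv_exp_ad K (x := -f) (by
    rw [map_neg]
    exact (isNilpotent_ad_of_lie_eq_smul (neg_ne_zero.mpr two_ne_zero) hhf).neg)
  have hnh : ⁅n, h⁆ = (-2 : K) • n := by rw [← lie_skew, hhn]; module
  have hfh : ⁅f, h⁆ = (2 : K) • f := by rw [← lie_skew, hhf]; module
  have hfn : ⁅f, n⁆ = -h := by rw [← lie_skew, hnf]
  have hEn : E n = n := by simp [hE]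
  have hEh : E h = h - (2 : K) • n := by
    rw [hE _ (by simp [hnh])]
    simp [hnh, sub_eq_add_neg]
  have hEf : E f = f + h - n := by
    rw [hE _ (by simp [hnf, hnh])]
    simp [hnf, hnh, sub_eq_add_neg]
  have hFn : F n = n + h - f := by
    rw [hF _ (by simp [hfn, hfh])]
    simp [hfn, hfh, sub_eq_add_neg]
  have hFh : F h = h - (2 : K) • f := by
    rw [hF _ (by simp [hfh])]
    simp [hfh, sub_eq_add_neg]
  refine ⟨(E.trans F).trans E, ?_, fun s hsn hsf ↦ ?_⟩
  · change E (F (E h)) = -h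
    rw [hEh, map_sub, map_smul, hFh, hFn]
    simp only [map_sub, map_smul, map_add, hEh, hEf, hEn]
    module
  · have hns : ⁅n, s⁆ = 0 := by rw [← lie_skew, hsn, neg_zero]
    have hfs : ⁅f, s⁆ = 0 := by rw [← lie_skew, hsf, neg_zero]
    change E (F (E s)) = s
    simp [hE, hF, hns, hfs]

theorem isSemisimple_ad_of_sl_two_triple {h n f : L} (hhn : ⁅h, n⁆ = (2 : K) • n)
    (hhf : ⁅h, f⁆ = (-2 : K) • f) (hnf : ⁅n, f⁆ = h) : (ad K L h).IsSemisimple := by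
  obtain ⟨w, hwh, hw⟩ := exists_lieEquiv_lie_eq_two_smul hhn hhf hnf
  obtain ⟨a, b, hab, ha, hb, hlie⟩ := exists_add_eq_isSemisimple_ad_isNilpotent_ad K h
  have hah : ⁅a, h⁆ = 0 := by simpa using hlie h 0 (by simp)
  have hwa : w a = a - (2 : K) • h := by
    have := hw (a - h) (by rw [sub_lie, hlie _ _ hhn, hhn, sub_self])
      (by rw [sub_lie, hlie _ _ hhf, hhf, sub_self])
    rw [map_sub, hwh] at this
    rw [two_smul, ← sub_sub, ← this]
    abel
  have hwa' : (ad K L (w a)).IsSemisimple := by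
    rw [← conj_ad_apply]
    exact (LinearEquiv.isSemisimple_iff _ _ w.toLinearEquiv (LinearMap.ext fun x ↦ by
      change w ⁅a, x⁆ = w ⁅a, w.symm (w x)⁆
      rw [LieEquiv.symm_apply_apply])).mp ha
  have haw : ⁅w a, a⁆ = 0 := by
    rw [hwa, sub_lie, lie_self, smul_lie, ← lie_skew h a, hah, neg_zero, smul_zero, sub_zero]
  have hcomm : Commute (ad K L (w a) : End K L) (ad K L a) := by
    refine LinearMap.ext fun x ↦ ?_
    have := leibniz_lie (w a) a x
    rwa [haw, zero_lie, zero_add] at this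
  have hb' : (-(2 : K)) • b = w a - (-a) := by
    rw [hwa, ← hab]
    module
  have hb0 : (ad K L ((-(2 : K)) • b) : End K L) = 0 := by
    refine Module.End.eq_zero_of_isNilpotent_isSemisimple ?_ ?_
    · rw [map_smul]
      exact hb.smul _
    · rw [hb', map_sub, map_neg]
      exact hwa'.sub_of_commute hcomm.neg_right (Module.End.isSemisimple_neg.mpr ha)
  have hb1 : b = 0 := by
    refine (LieDerivation.IsKilling.ad_apply_eq_zero_iff (R := K)
      L b).mp (LieDerivation.ext fun x ↦ ?_)
    simpa using LinearMap.congr_fun hb0 x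
  rwa [← hab, hb1, add_zero]

omit [IsAlgClosed K] [IsKilling K L] in
theorem exists_lie_eq_of_lie_eq_two_smul {s h n f : L} (hsn : ⁅s, n⁆ = 0) (hsf : ⁅s, f⁆ = 0)
    (hhn : ⁅h, n⁆ = (2 : K) • n) (hhf : ⁅h, f⁆ = (-2 : K) • f) (hnf : ⁅n, f⁆ = h) {v : L}
    (hsv : ⁅s, v⁆ = 0) (hhv : ⁅h, v⁆ = (2 : K) • v) :
    ∃ m : L, ⁅s, m⁆ = 0 ∧ ⁅h, m⁆ = 0 ∧ ⁅n, m⁆ = v := by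
  have hA := isNilpotent_ad_of_lie_eq_smul two_ne_zero hhn
  have hF := isNilpotent_ad_of_lie_eq_smul (neg_ne_zero.mpr two_ne_zero) hhf
  have hfn : ⁅f, n⁆ = -h := by rw [← lie_skew, hnf]
  let V : Submodule K L := LinearMap.ker (ad K L s : End K L) ⊓ LinearMap.ker ((ad K L h : End K L)
    - (2 : K) • 1)
  have hV (x : L) : x ∈ V ↔ ⁅s, x⁆ = 0 ∧ ⁅h, x⁆ = (2 : K) • x := by
    simp [V, sub_eq_zero]
  have hfV {x : L} (hx : ⁅h, x⁆ = (2 : K) • x) : ⁅h, ⁅f, x⁆⁆ = 0 := by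
    rw [leibniz_lie, hhf, hx]
    simp
  have hs' {a b : L} (ha : ⁅s, a⁆ = 0) (hb : ⁅s, b⁆ = 0) : ⁅s, ⁅a, b⁆⁆ = 0 := by
    rw [leibniz_lie, ha, hb, zero_lie, lie_zero, zero_add]
  have hmap (x : L) (hx : x ∈ V) : ((ad K L n : End K L) * ad K L f) x ∈ V := by
    rw [hV] at hx ⊢
    refine ⟨hs' hsn (hs' hsf hx.1), ?_⟩
    change ⁅h, ⁅n, ⁅f, x⁆⁆⁆ = (2 : K) • ⁅n, ⁅f, x⁆⁆
    rw [leibniz_lie, hhn, hfV hx.2]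
    simp
  let R : V →ₗ[K] V := LinearMap.restrict _ hmap
  have hlow {k : ℕ} {x : L} {μ : K} (hx0 : x ≠ 0) (hfx : ⁅f, x⁆ = 0) (hhx : ⁅h, x⁆ = μ • x)
      (hk : x ∈ LinearMap.range ((ad K L f : End K L) ^ k)) : ∃ j : ℕ, k ≤ j ∧ -μ = j :=
    Module.End.exists_eq_natCast_of_mem_range_pow (A := ad K L f) (B := ad K L n) (C := -ad K L h)
      (by ext y; simp [← lie_lie, hfn]) (by
        ext y
        have := leibniz_lie h f y
        rw [hhf, smul_lie] at this
        simp only [LinearMap.sub_apply, Module.End.mul_apply, LinearMap.neg_apply, ad_apply, this,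
          LinearMap.smul_apply, lie_neg]
        module) hF hx0 hfx (by simp [hhx]) hk
  have hR : Function.Injective R := by
    rw [injective_iff_map_eq_zero]
    rintro ⟨x, hx⟩ hRx
    have h1 : ⁅n, ⁅f, x⁆⁆ = 0 := congrArg Subtype.val hRx
    rw [hV] at hx
    ext
    by_contra hx0
    change x ≠ 0 at hx0
    have hfx : ⁅f, x⁆ ≠ 0 := fun hfx ↦ by
      obtain ⟨j, -, hj⟩ := hlow (k := 0) hx0 hfx hx.2 (by simp)
      have : ((j + 2 : ℕ) : K) = 0 := by push_cast; rw [← hj]; ring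
      exact absurd (Nat.cast_eq_zero.mp this) (by omega)
    have hffx : ⁅f, ⁅f, x⁆⁆ = 0 := by
      refine lie_ne_neg_two_smul_of_isNilpotent_ad hA hnf hhn ?_ ?_
      · rw [leibniz_lie, hnf, hfV hx.2, h1, lie_zero, add_zero]
      · rw [leibniz_lie, hhf, hfV hx.2, lie_zero, add_zero, smul_lie]
    obtain ⟨j, hj1, hj⟩ := hlow (k := 1) (μ := 0) hfx hffx (by rw [hfV hx.2, zero_smul]) ⟨x,
        by simp⟩
    rw [neg_zero, eq_comm, Nat.cast_eq_zero] at hj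
    omega
  obtain ⟨⟨x, hx⟩, hRx⟩ := LinearMap.injective_iff_surjective.mp hR ⟨v, (hV v).mpr ⟨hsv, hhv⟩⟩
  rw [hV] at hx
  exact ⟨⁅f, x⁆, hs' hsf hx.1, hfV hx.2, congrArg Subtype.val hRx⟩

end

end LieAlgebra

section

open scoped TensorProduct

theorem IsAlgClosed.nonempty_algHom_of_finiteType (K A : Type*) [Field K] [IsAlgClosed K]
    [CommRing A]
    [Nontrivial A] [Algebra K A] [Algebra.FiniteType K A] : Nonempty (A →ₐ[K] K) := by
  obtain ⟨m, hm⟩ := Ideal.exists_maximal A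
  let := Ideal.Quotient.field m
  have := finite_of_finite_type_of_isJacobsonRing K (A ⧸ m)
  have hb := IsAlgClosed.algebraMap_bijective_of_isIntegral (k := K) (K := A ⧸ m)
  exact ⟨(AlgEquiv.ofBijective (Algebra.ofId K (A ⧸ m)) hb).symm.toAlgHom.comp
    (Ideal.Quotient.mkₐ K m)⟩

theorem IsAlgClosed.exists_algHom_comp_eq {K R B B' : Type*} [Field K] [IsAlgClosed K]
    [CommRing R] [IsDomain R] [CommRing B] [CommRing B'] [Algebra K R] [Algebra K B] [Algebra K B']
    [Algebra.FiniteType K B] [Algebra.FiniteType K B'] (f : R →ₐ[K] B) (f' : R →ₐ[K] B')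
    (hf : Function.Injective f) (hf' : Function.Injective f') :
    ∃ (p : B →ₐ[K] K) (p' : B' →ₐ[K] K), p.comp f = p'.comp f' := by
  have hmin : (⊥ : Ideal R) ∈ minimalPrimes R := by
    rw [IsDomain.minimalPrimes_eq_singleton_bot]; rfl
  obtain ⟨P, hP, hPf⟩ := Ideal.exists_comap_eq_of_mem_minimalPrimes_of_injective
    (f := f.toRingHom) hf ⊥ hmin
  obtain ⟨P', hP', hPf'⟩ := Ideal.exists_comap_eq_of_mem_minimalPrimes_of_injective
    (f := f'.toRingHom) hf' ⊥ hmin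
  let g : R →ₐ[K] B ⧸ P := (Ideal.Quotient.mkₐ K P).comp f
  let g' : R →ₐ[K] B' ⧸ P' := (Ideal.Quotient.mkₐ K P').comp f'
  let : Algebra R (B ⧸ P) := g.toAlgebra
  let : Algebra R (B' ⧸ P') := g'.toAlgebra
  have : IsScalarTower K R (B ⧸ P) := IsScalarTower.of_algHom g
  have : IsScalarTower K R (B' ⧸ P') := IsScalarTower.of_algHom g'
  have hg : Function.Injective (algebraMap R (B ⧸ P)) := by
    rw [injective_iff_map_eq_zero]
    intro a ha
    have : a ∈ P.comap f.toRingHom := Ideal.mem_comap.mpr <| Ideal.Quotient.eq_zero_iff_mem.mp ha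
    rwa [hPf] at this
  have hg' : Function.Injective (algebraMap R (B' ⧸ P')) := by
    rw [injective_iff_map_eq_zero]
    intro a ha
    have : a ∈ P'.comap f'.toRingHom := Ideal.mem_comap.mpr <| Ideal.Quotient.eq_zero_iff_mem.mp ha
    rwa [hPf'] at this
  have := Algebra.TensorProduct.nontrivial_of_algebraMap_injective_of_isDomain R (B ⧸ P) (B' ⧸ P')
    hg hg'
  have : Algebra.FiniteType R (B' ⧸ P') := Algebra.FiniteType.of_restrictScalars_finiteType K R _
  have : Algebra.FiniteType (B ⧸ P) ((B ⧸ P) ⊗[R] (B' ⧸ P')) := inferInstance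
  have : Algebra.FiniteType K ((B ⧸ P) ⊗[R] (B' ⧸ P')) := Algebra.FiniteType.trans (S := B ⧸ P)
      inferInstance this
  obtain ⟨φ⟩ := IsAlgClosed.nonempty_algHom_of_finiteType K ((B ⧸ P) ⊗[R] (B' ⧸ P'))
  refine ⟨φ.comp (Algebra.TensorProduct.includeLeft.comp (Ideal.Quotient.mkₐ K P)),
    φ.comp ((Algebra.TensorProduct.includeRight.restrictScalars K).comp (Ideal.Quotient.mkₐ K P')),
    ?_⟩
  ext r
  have h := (Algebra.TensorProduct.includeLeft (R := R) (S := R) (A := B ⧸ P)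
      (B := B' ⧸ P')).commutes r
  rw [← (Algebra.TensorProduct.includeRight (R := R) (A := B ⧸ P) (B := B' ⧸ P')).commutes r] at h
  exact congr_arg φ h

open MvPolynomial in
theorem Derivation.apply_aeval {σ K B : Type*} [Fintype σ] [CommRing K] [CommRing B] [Algebra K B]
    (d : Derivation K B B) (q : MvPolynomial σ K →ₐ[K] B) (P : MvPolynomial σ K) :
    d (q P) = ∑ k, q (pderiv k P) * d (q (X k)) := by
  classical
  induction P using MvPolynomial.induction_on with
  | C a => simp [← MvPolynomial.algebraMap_eq]
  | add p p' hp hp' => simp [hp, hp', add_mul, Finset.sum_add_distrib]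
  | mul_X p i hp =>
    simp only [map_mul, Derivation.leibniz, pderiv_X, smul_eq_mul, hp, map_add, add_mul,
      Finset.sum_add_distrib]
    congr 1
    · rw [Finset.sum_eq_single i] <;> simp +contextual
    · rw [Finset.mul_sum]
      exact Finset.sum_congr rfl fun k _ ↦ by ring

open scoped Matrix

namespace MvPolynomial

theorem totalDegree_pderiv_lt {σ K : Type*} [CommRing K] (P : MvPolynomial σ K) (k : σ)
    (hP : pderiv k P ≠ 0) : (pderiv k P).totalDegree < P.totalDegree := by
  classical
  obtain ⟨m, hm, hmd⟩ := Finset.exists_mem_eq_sup (pderiv k P).support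
    (by simpa [Finset.nonempty_iff_ne_empty] using hP) (fun s ↦ s.sum fun _ e ↦ e)
  rw [totalDegree, hmd]
  rw [mem_support_iff, coeff_pderiv] at hm
  have h2 := le_totalDegree (p := P) (s := m + Finsupp.single k 1) (by
    rw [mem_support_iff]; exact left_ne_zero_of_mul hm)
  rw [Finsupp.sum_add_index' (by simp) (by simp)] at h2
  simp at h2
  omega

theorem eq_C_of_pderiv_eq_zero {σ K : Type*} [Field K] [CharZero K] (P : MvPolynomial σ K)
    (h : ∀ k, pderiv k P = 0) : P = C (coeff 0 P) := by
  classical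
  ext m
  rw [coeff_C]
  split_ifs with hm
  · rw [hm]
  · obtain ⟨k, hk⟩ : ∃ k, m k ≠ 0 := by
      by_contra! H
      exact hm (Finsupp.ext fun k ↦ (H k).symm)
    have := congrArg (coeff (m - Finsupp.single k 1)) (h k)
    rw [coeff_pderiv, coeff_zero] at this
    have h2 : m - Finsupp.single k 1 + Finsupp.single k 1 = m := by
      ext j
      by_cases hj : j = k
      · subst hj; simp; omega
      · simp [Ne.symm hj]
    rw [h2] at this
    exact (mul_eq_zero.mp this).resolve_right (Nat.cast_add_one_ne_zero _)

theorem injective_of_derivation {σ K B : Type*} [Fintype σ] [DecidableEq σ] [Field K] [CharZero K]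
    [CommRing B] [Nontrivial B] [Algebra K B] (q : MvPolynomial σ K →ₐ[K] B)
    (d : σ → Derivation K B B) (W : Matrix σ σ B)
    (hW : W * Matrix.of (fun j k ↦ d j (q (X k))) = 1) : Function.Injective q := by
  rw [injective_iff_map_eq_zero]
  suffices H : ∀ (n : ℕ) (P : MvPolynomial σ K), P.totalDegree < n → q P = 0 → P = 0 from
    fun P ↦ H _ P (Nat.lt_succ_self _)
  intro n
  induction n with
  | zero => simp
  | succ n ih =>
    intro P hdeg hP
    have hz : Matrix.of (fun j k ↦ d j (q (X k))) *ᵥ (fun k ↦ q (pderiv k P)) = 0 := by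
      ext j
      have := (d j).apply_aeval q P
      rw [hP, map_zero] at this
      simp only [Matrix.mulVec, dotProduct, Matrix.of_apply, Pi.zero_apply]
      rw [this]
      exact Finset.sum_congr rfl fun k _ ↦ mul_comm _ _
    have hz' : (fun k ↦ q (pderiv k P)) = 0 := by
      rw [← Matrix.one_mulVec (fun k ↦ q (pderiv k P)), ← hW, ← Matrix.mulVec_mulVec, hz,
        Matrix.mulVec_zero]
    have hp : ∀ k, pderiv k P = 0 := by
      intro k
      by_contra hk
      exact hk (ih _ (by have := totalDegree_pderiv_lt P k hk; omega) (congrFun hz' k))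
    rw [eq_C_of_pderiv_eq_zero P hp] at hP ⊢
    rw [← algebraMap_eq, AlgHom.commutes] at hP
    rw [(map_eq_zero_iff _ (FaithfulSMul.algebraMap_injective K B)).mp hP, map_zero]

end MvPolynomial

/-- The matrix equations `G * G' = 1`, `G * D i = (∑ k, G k i • D k) * G`, `G * N t = N t * G`,
written as a family of matrices which vanishes exactly on their solutions. -/
def autDefect {ι τ K : Type*} [Fintype ι] [DecidableEq ι] [Field K]
    (D : ι → Matrix ι ι K) (N : τ → Matrix ι ι K) {A : Type*} [CommRing A] [Algebra K A]
    (G G' : Matrix ι ι A) : Unit ⊕ ι ⊕ τ → Matrix ι ι A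
  | .inl _ => G * G' - 1
  | .inr (.inl i) =>
    G * (D i).map (algebraMap K A) - (∑ k, G k i • (D k).map (algebraMap K A)) * G
  | .inr (.inr t) => G * (N t).map (algebraMap K A) - (N t).map (algebraMap K A) * G

section

variable {ι τ K : Type*} [Fintype ι] [DecidableEq ι] [Field K]
  {D : ι → Matrix ι ι K} {N : τ → Matrix ι ι K} {A : Type*} [CommRing A] [Algebra K A]
  {A' : Type*} [CommRing A'] [Algebra K A']

theorem autDefect_map (f : A →ₐ[K] A') (G G' : Matrix ι ι A) (r : Unit ⊕ ι ⊕ τ) :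
    autDefect D N (G.map f) (G'.map f) r = (autDefect D N G G' r).map f := by
  have h (M : Matrix ι ι K) : M.map (algebraMap K A')
      = f.toRingHom.mapMatrix (M.map (algebraMap K A)) := by
    ext; simp
  have h' (M : Matrix ι ι A) : M.map f = f.toRingHom.mapMatrix M := rfl
  have h'' (a : A) (M : Matrix ι ι A) : f.toRingHom.mapMatrix (a • M)
      = f a • f.toRingHom.mapMatrix M := by
    ext; simp
  rcases r with _ | i | t
  all_goals simp only [autDefect, h, h', map_sub, map_mul, map_one, map_sum, h'']
  all_goals rfl

theorem autDefect_eq_zero_iff {G G' : Matrix ι ι A} : autDefect D N G G' = 0 ↔ G * G' = 1 ∧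
    (∀ i, G * (D i).map (algebraMap K A) = (∑ k, G k i • (D k).map (algebraMap K A)) * G) ∧
    ∀ t, G * (N t).map (algebraMap K A) = (N t).map (algebraMap K A) * G := by
  simp [funext_iff, autDefect, sub_eq_zero, Sum.forall]

theorem autDefect_mul_eq_zero {G G' H H' : Matrix ι ι A} (h : autDefect D N G G' = 0)
    (h' : autDefect D N H H' = 0) : autDefect D N (G * H) (H' * G') = 0 := by
  rw [autDefect_eq_zero_iff] at *
  obtain ⟨h1, h2, h3⟩ := h
  obtain ⟨h1', h2', h3'⟩ := h'
  refine ⟨?_, fun i ↦ ?_, fun t ↦ ?_⟩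
  · rw [Matrix.mul_assoc, ← Matrix.mul_assoc H, h1', Matrix.one_mul, h1]
  · rw [Matrix.mul_assoc, h2', ← Matrix.mul_assoc, ← Matrix.mul_assoc]
    congr 1
    simp only [Matrix.mul_sum, Matrix.mul_smul, h2, Matrix.mul_apply, Finset.sum_smul,
      Finset.smul_sum, Finset.sum_mul, Matrix.smul_mul, smul_smul]
    rw [Finset.sum_comm]
    exact Finset.sum_congr rfl fun _ _ ↦ Finset.sum_congr rfl fun _ _ ↦ by rw [mul_comm]
  · rw [Matrix.mul_assoc, h3', ← Matrix.mul_assoc, h3, Matrix.mul_assoc]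

theorem autDefect_one_add_smul {Y : Matrix ι ι K} (hD : ∀ i, Y * D i - D i * Y = ∑ k, Y k i • D k)
    (hN : ∀ t, Y * N t = N t * Y) (ε : A) (hε : ε * ε = 0) :
    autDefect D N (1 + ε • Y.map (algebraMap K A)) (1 - ε • Y.map (algebraMap K A)) = 0 := by
  rw [autDefect_eq_zero_iff]
  set φ := (algebraMap K A).mapMatrix (m := ι)
  have h' (M : Matrix ι ι K) : M.map (algebraMap K A) = φ M := rfl
  refine ⟨?_, fun i ↦ ?_, fun t ↦ ?_⟩
  · simp [mul_sub, add_mul, smul_smul, hε]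
  · have h1 : φ Y * φ (D i) = φ (D i) * φ Y + ∑ k, algebraMap K A (Y k i) • φ (D k) := by
      rw [← map_mul, ← map_mul, ← sub_eq_iff_eq_add', ← map_sub, hD, map_sum]
      refine Finset.sum_congr rfl fun k _ ↦ ?_
      ext; simp [φ]
    have h2 : ∑ k, (1 + ε • φ Y) k i • φ (D k)
        = φ (D i) + ε • ∑ k, algebraMap K A (Y k i) • φ (D k) := by
      simp [add_smul, Finset.sum_add_distrib, Matrix.one_apply, Finset.smul_sum, mul_smul, φ]
    simp only [h']
    rw [h2]
    simp [add_mul, mul_add, h1, smul_smul, hε]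
    abel
  · simp only [h']
    rw [add_mul, mul_add, Matrix.smul_mul, Matrix.mul_smul, ← map_mul, hN, map_mul, one_mul,
      mul_one]

variable (D N) in
/-- The ideal defining the scheme of solutions of `autDefect D N G G' = 0`. -/
noncomputable def autIdeal : Ideal (MvPolynomial ((ι × ι) ⊕ (ι × ι)) K) :=
  Ideal.span (Set.range fun (p : (Unit ⊕ ι ⊕ τ) × ι × ι) ↦
    autDefect D N (Matrix.of fun i j ↦ MvPolynomial.X (.inl (i, j)))
      (Matrix.of fun i j ↦ MvPolynomial.X (.inr (i, j))) p.1 p.2.1 p.2.2)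

variable (D N) in
/-- The coordinate ring of the scheme of solutions of `autDefect D N G G' = 0`. -/
abbrev AutRing : Type _ := MvPolynomial ((ι × ι) ⊕ (ι × ι)) K ⧸ autIdeal D N

variable (D N) in
/-- The universal solution of `autDefect D N G G' = 0`. -/
noncomputable def autUniv : Matrix ι ι (AutRing D N) :=
  Matrix.of fun i j ↦ Ideal.Quotient.mkₐ K _ (MvPolynomial.X (.inl (i, j)))

variable (D N) in
/-- The inverse of the universal solution `autUniv D N`. -/
noncomputable def autUniv' : Matrix ι ι (AutRing D N) :=
  Matrix.of fun i j ↦ Ideal.Quotient.mkₐ K _ (MvPolynomial.X (.inr (i, j)))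

theorem autDefect_autUniv : autDefect D N (autUniv D N) (autUniv' D N) = 0 := by
  ext r i j
  exact congrFun₂ (autDefect_map (D := D) (N := N) (Ideal.Quotient.mkₐ K (autIdeal D N))
      (Matrix.of fun i j ↦ MvPolynomial.X (.inl (i, j)))
      (Matrix.of fun i j ↦ MvPolynomial.X (.inr (i, j))) r) i j |>.trans
    (Ideal.Quotient.eq_zero_iff_mem.mpr (Ideal.subset_span ⟨(r, i, j), rfl⟩))

theorem exists_autUniv_map_eq (G G' : Matrix ι ι A) (h : autDefect D N G G' = 0) :
    ∃ f : AutRing D N →ₐ[K] A, (autUniv D N).map f = G ∧ (autUniv' D N).map f = G' := by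
  let g : MvPolynomial ((ι × ι) ⊕ (ι × ι)) K →ₐ[K] A :=
    MvPolynomial.aeval (Sum.elim (fun p ↦ G p.1 p.2) (fun p ↦ G' p.1 p.2))
  have hg : (Matrix.of fun i j ↦ (MvPolynomial.X (.inl (i, j)) :
      MvPolynomial ((ι × ι) ⊕ (ι × ι)) K)).map g = G := by
    ext; simp [g]
  have hg' : (Matrix.of fun i j ↦ (MvPolynomial.X (.inr (i, j)) :
      MvPolynomial ((ι × ι) ⊕ (ι × ι)) K)).map g = G' := by
    ext; simp [g]
  have hk : autIdeal D N ≤ RingHom.ker g := by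
    rw [autIdeal, Ideal.span_le]
    rintro _ ⟨⟨r, i, j⟩, rfl⟩
    have := autDefect_map (D := D) (N := N) g (Matrix.of fun i j ↦ MvPolynomial.X (.inl (i, j)))
      (Matrix.of fun i j ↦ MvPolynomial.X (.inr (i, j))) r
    rw [hg, hg', h] at this
    exact (congrFun (congrFun this i) j).symm
  refine ⟨Ideal.Quotient.liftₐ _ g hk, ?_, ?_⟩
  · ext i j
    exact congrFun₂ hg i j
  · ext i j
    exact congrFun₂ hg' i j

theorem autRing_hom_ext {f f' : AutRing D N →ₐ[K] A} (h :
    (autUniv D N).map f = (autUniv D N).map f')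
    (h' : (autUniv' D N).map f = (autUniv' D N).map f') : f = f' := by
  apply Ideal.Quotient.algHom_ext
  ext (⟨i, j⟩ | ⟨i, j⟩)
  · exact congrFun₂ h i j
  · exact congrFun₂ h' i j

instance : Nontrivial (AutRing D N) := by
  obtain ⟨f, -⟩ := exists_autUniv_map_eq (D := D) (N := N) (A := K) 1 1 (by
    simpa using autDefect_one_add_smul (D := D) (N := N) (Y := 0) (by simp) (by simp) (0 : K))
  exact f.toRingHom.domain_nontrivial

theorem Matrix.exists_derivation_map_eq {ι : Type*} {K B : Type*} [CommRing K] [CommRing B]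
    [Algebra K B]
    {U Z : Matrix ι ι B} (f : B →ₐ[K] DualNumber B)
    (hf : (TrivSqZeroExt.fstHom K B B).comp f = AlgHom.id K B)
    (hU : U.map f = U.map (TrivSqZeroExt.inlAlgHom K B B) +
      (DualNumber.eps : DualNumber B) • Z.map (TrivSqZeroExt.inlAlgHom K B B)) :
    ∃ d : Derivation K B B, U.map d = Z := by
  have hf' (b : B) : (f b).fst = b := DFunLike.congr_fun hf b
  refine ⟨Derivation.mk' ((TrivSqZeroExt.sndHom B B).restrictScalars K ∘ₗ f.toLinearMap) ?_, ?_⟩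
  · intro a b
    simp [hf', mul_comm]
  · ext i j : 1
    simpa using congrArg TrivSqZeroExt.snd (congrFun₂ hU i j)

theorem autDefect_map_inl_mul_eq_zero {Y : Matrix ι ι K} {U U' : Matrix ι ι A}
    (hD : ∀ i, Y * D i - D i * Y = ∑ k, Y k i • D k) (hN : ∀ t, Y * N t = N t * Y)
    (hU : autDefect D N U U' = 0) :
    autDefect D N
      (U.map (TrivSqZeroExt.inlAlgHom K A A) + (DualNumber.eps : DualNumber A) •
        (U * Y.map (algebraMap K A)).map (TrivSqZeroExt.inlAlgHom K A A))
      (U'.map (TrivSqZeroExt.inlAlgHom K A A) - (DualNumber.eps : DualNumber A) •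
        (Y.map (algebraMap K A) * U').map (TrivSqZeroExt.inlAlgHom K A A)) = 0 := by
  let inl : A →ₐ[K] DualNumber A := TrivSqZeroExt.inlAlgHom K A A
  have h0 := autDefect_one_add_smul hD hN (DualNumber.eps : DualNumber A)
    DualNumber.eps_mul_eps
  have h1 : autDefect D N (U.map inl) (U'.map inl) = 0 := by
    funext r
    rw [autDefect_map, hU]
    ext : 1
    simp
  have h2 := autDefect_mul_eq_zero h1 h0
  have hY : Y.map (algebraMap K (DualNumber A)) = (Y.map (algebraMap K A)).map inl := by
    ext i j : 1
    exact (inl.commutes _).symm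
  have hmap (P Q : Matrix ι ι A) : P.map inl * Q.map inl = (P * Q).map inl :=
    (Matrix.map_mul (f := inl.toRingHom)).symm
  rwa [hY, mul_add, mul_one, Matrix.mul_smul, hmap, sub_mul, one_mul, Matrix.smul_mul, hmap] at h2

theorem exists_derivation_autRing {Y : Matrix ι ι K}
    (hD : ∀ i, Y * D i - D i * Y = ∑ k, Y k i • D k) (hN : ∀ t, Y * N t = N t * Y) :
    ∃ d : Derivation K (AutRing D N) (AutRing D N),
      (autUniv D N).map d = autUniv D N * Y.map (algebraMap K _) := by
  obtain ⟨f, hf, hf'⟩ := exists_autUniv_map_eq _ _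
    (autDefect_map_inl_mul_eq_zero hD hN (autDefect_autUniv (D := D) (N := N)))
  refine Matrix.exists_derivation_map_eq f (autRing_hom_ext ?_ ?_) hf
  · ext i j : 1
    simpa using congrArg TrivSqZeroExt.fst (congrFun₂ hf i j)
  · ext i j : 1
    simpa using congrArg TrivSqZeroExt.fst (congrFun₂ hf' i j)

end

section

variable {ι κ τ K : Type*} [Fintype ι] [DecidableEq ι] [Fintype κ] [DecidableEq κ] [Fintype τ]
  [Field K]
  {D : ι → Matrix ι ι K} {N : τ → Matrix ι ι K} {V : Matrix ι κ K} {Λ : Matrix κ ι K}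
  {C : τ → Matrix ι ι K}

omit [DecidableEq κ] in
theorem mul_mul_eq_of_commute {A : Type*} [CommRing A] [Algebra K A]
    (hNV : ∀ t, N t * V = 0)
    (hVΛ : V * Λ = 1 - ∑ t, C t * N t) {G : Matrix ι ι A}
    (hG : ∀ t, G * (N t).map (algebraMap K A) = (N t).map (algebraMap K A) * G) :
    V.map (algebraMap K A) * Λ.map (algebraMap K A) * (G * V.map (algebraMap K A))
      = G * V.map (algebraMap K A) := by
  have h (t) : (N t).map (algebraMap K A) * (G * V.map (algebraMap K A)) = 0 := by
    rw [← Matrix.mul_assoc, ← hG, Matrix.mul_assoc, ← Matrix.map_mul, hNV]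
    simp
  have h' : (1 - ∑ t, C t * N t).map (algebraMap K A)
      = 1 - ∑ t, (C t).map (algebraMap K A) * (N t).map (algebraMap K A) := by
    simp only [← Matrix.map_mul]
    exact (map_sub (algebraMap K A).mapMatrix _ _).trans (by simp)
  rw [← Matrix.map_mul, hVΛ, h', Matrix.sub_mul, Matrix.one_mul, Matrix.sum_mul, sub_eq_self]
  refine Finset.sum_eq_zero fun t _ ↦ ?_
  rw [Matrix.mul_assoc, h, Matrix.mul_zero]

variable (D N Λ) in
/-- The comorphism of the orbit map `G ↦ Λ (G n)`. -/
noncomputable def autOrbit (n : ι → K) : MvPolynomial κ K →ₐ[K] AutRing D N :=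
  MvPolynomial.aeval ((Λ.map (algebraMap K _) * autUniv D N) *ᵥ (algebraMap K (AutRing D N) ∘ n))

theorem autOrbit_injective [CharZero K] (hΛV : Λ * V = 1) (hNV : ∀ t, N t * V = 0)
    (hVΛ : V * Λ = 1 - ∑ t, C t * N t) {n : ι → K} (Y : κ → Matrix ι ι K)
    (hD : ∀ j i, Y j * D i - D i * Y j = ∑ k, Y j k i • D k) (hN : ∀ j t, Y j * N t = N t * Y j)
    (hY : ∀ j, Y j *ᵥ n = V.col j) : Function.Injective (autOrbit D N Λ n) := by
  choose d hd using fun j ↦ exists_derivation_autRing (hD j) (hN j)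
  obtain ⟨h1, -, h3⟩ := autDefect_eq_zero_iff.mp (autDefect_autUniv (D := D) (N := N))
  set U := autUniv D N
  set U' := autUniv' D N
  set φ := algebraMap K (AutRing D N)
  have h4 (t) : U' * (N t).map φ = (N t).map φ * U' := by
    have h1' := mul_eq_one_comm.mp h1
    rw [← Matrix.mul_one (U' * _), ← h1, ← Matrix.mul_assoc, Matrix.mul_assoc U' _ U, ← h3,
      ← Matrix.mul_assoc, h1', Matrix.one_mul]
  refine MvPolynomial.injective_of_derivation _ d (Λ.map φ * U' * V.map φ)ᵀ ?_
  have hM : Matrix.of (fun j k ↦ d j (autOrbit D N Λ n (MvPolynomial.X k)))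
      = (Λ.map φ * U * V.map φ)ᵀ := by
    have hφ (j) : (Y j).map φ *ᵥ (φ ∘ n) = φ ∘ V.col j := by
      rw [← hY]
      ext i
      simp [Matrix.mulVec, dotProduct]
    have hdj (j) : d j ∘ ((Λ.map φ * U) *ᵥ (φ ∘ n)) = (Λ.map φ * U.map (d j)) *ᵥ (φ ∘ n) := by
      ext i
      simp [Matrix.mulVec, dotProduct, Matrix.mul_apply, φ, mul_comm]
    ext j k : 1
    simp only [Matrix.of_apply, autOrbit, MvPolynomial.aeval_X, Matrix.transpose_apply]
    refine (congrFun (hdj j) k).trans ?_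
    rw [hd, ← Matrix.mul_assoc, ← Matrix.mulVec_mulVec, hφ]
    rfl
  rw [hM, ← Matrix.transpose_mul, ← Matrix.transpose_one, Matrix.mul_assoc (Λ.map φ) U',
    Matrix.mul_assoc (Λ.map φ) U, Matrix.mul_assoc (Λ.map φ), Matrix.mul_assoc U,
    ← Matrix.mul_assoc (V.map φ),
    mul_mul_eq_of_commute hNV hVΛ h4, ← Matrix.mul_assoc U, h1, Matrix.one_mul, ← Matrix.map_mul,
      hΛV]
  congr 1
  ext : 1
  simp [Matrix.one_apply, apply_ite]

theorem exists_autDefect_eq_zero_mulVec_eq [CharZero K] [IsAlgClosed K] (hΛV : Λ * V = 1)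
    (hNV : ∀ t, N t * V = 0) (hVΛ : V * Λ = 1 - ∑ t, C t * N t) {n n' : ι → K}
    (hn : ∀ t, N t *ᵥ n = 0) (hn' : ∀ t, N t *ᵥ n' = 0)
    (Y Y' : κ → Matrix ι ι K)
    (hD : ∀ j i, Y j * D i - D i * Y j = ∑ k, Y j k i • D k) (hN : ∀ j t, Y j * N t = N t * Y j)
    (hY : ∀ j, Y j *ᵥ n = V.col j)
    (hD' : ∀ j i, Y' j * D i - D i * Y' j = ∑ k, Y' j k i • D k)
    (hN' : ∀ j t, Y' j * N t = N t * Y' j) (hY' : ∀ j, Y' j *ᵥ n' = V.col j) :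
    ∃ G₁ G₁' G₂ G₂' : Matrix ι ι K, autDefect D N G₁ G₁' = 0 ∧ autDefect D N G₂ G₂' = 0 ∧
      G₁ *ᵥ n = G₂ *ᵥ n' := by
  obtain ⟨p, p', h⟩ := IsAlgClosed.exists_algHom_comp_eq _ _
    (autOrbit_injective hΛV hNV hVΛ Y hD hN hY) (autOrbit_injective hΛV hNV hVΛ Y' hD' hN' hY')
  have hz (f : AutRing D N →ₐ[K] K) :
      autDefect D N ((autUniv D N).map f) ((autUniv' D N).map f) = 0 := by
    funext r
    rw [autDefect_map, autDefect_autUniv]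
    ext : 1
    simp
  refine ⟨_, _, _, _, hz p, hz p', ?_⟩
  have h1 (f : AutRing D N →ₐ[K] K) (m : ι → K) (k : κ) : f (autOrbit D N Λ m (MvPolynomial.X k))
      = (Λ *ᵥ ((autUniv D N).map f *ᵥ m)) k := by
    have h3 : (Λ.map (algebraMap K (AutRing D N)) * autUniv D N).map f
        = Λ * (autUniv D N).map f := by
      rw [← AlgHom.coe_toRingHom, Matrix.map_mul]
      congr 1
      ext : 1
      simp
    rw [Matrix.mulVec_mulVec, ← h3]
    simp [autOrbit, Matrix.mulVec, dotProduct]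
    rfl
  have h2 (f : AutRing D N →ₐ[K] K) (m : ι → K) (hm : ∀ t, N t *ᵥ m = 0) :
      V *ᵥ (Λ *ᵥ ((autUniv D N).map f *ᵥ m)) = (autUniv D N).map f *ᵥ m := by
    have h3 (t) := (autDefect_eq_zero_iff.mp (hz f)).2.2 t
    simp only [Algebra.algebraMap_self, RingHom.coe_id, Matrix.map_id] at h3
    rw [Matrix.mulVec_mulVec, hVΛ, Matrix.sub_mulVec, Matrix.one_mulVec, sub_eq_self,
      Matrix.sum_mulVec]
    refine Finset.sum_eq_zero fun t _ ↦ ?_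
    rw [← Matrix.mulVec_mulVec, Matrix.mulVec_mulVec _ (N t), ← h3, ← Matrix.mulVec_mulVec, hm,
      Matrix.mulVec_zero, Matrix.mulVec_zero]
  rw [← h2 p n hn, ← h2 p' n' hn']
  congr 1
  ext k
  rw [← h1, ← h1]
  exact DFunLike.congr_fun h _

end

namespace LieAlgebra

open Module

variable {K L : Type*} [Field K] [LieRing L] [LieAlgebra K L]

theorem exists_lieEquiv_toLin_eq {ι τ : Type*} [Fintype ι] [DecidableEq ι] (b : Module.Basis ι K L)
    (T : τ → End K L) {G G' : Matrix ι ι K}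
    (h : autDefect (fun i ↦ LinearMap.toMatrix b b (ad K L (b i)))
      (fun t ↦ LinearMap.toMatrix b b (T t)) G G' = 0) :
    ∃ g : L ≃ₗ⁅K⁆ L, (∀ x, g x = Matrix.toLin b b G x) ∧ ∀ t x, g (T t x) = T t (g x) := by
  obtain ⟨h1, h2, h3⟩ := autDefect_eq_zero_iff.mp h
  simp only [Algebra.algebraMap_self, RingHom.coe_id, Matrix.map_id] at h2 h3
  set g := Matrix.toLin b b G
  set g' := Matrix.toLin b b G'
  have hg : G = LinearMap.toMatrix b b g := by simp [g]
  have hb (i) : g (b i) = ∑ k, G k i • b k := by simp [g, Matrix.toLin_self]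
  have h2' (i) : g ∘ₗ (ad K L (b i) : End K L) = (ad K L (g (b i)) : End K L) ∘ₗ g := by
    apply (LinearMap.toMatrix b b).injective
    rw [LinearMap.toMatrix_comp b b b, LinearMap.toMatrix_comp b b b, ← hg, h2, hb]
    simp
  have h2'' (x y) : g ⁅x, y⁆ = ⁅g x, g y⁆ := by
    let A : L →ₗ[K] End K L := (LinearMap.llcomp K L L L g) ∘ₗ (ad K L : L →ₗ[K] End K L)
    let A' : L →ₗ[K] End K L := (LinearMap.lcomp K L g) ∘ₗ (ad K L : L →ₗ[K] End K L) ∘ₗ g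
    have hA : A = A' := b.ext h2'
    exact LinearMap.congr_fun (LinearMap.congr_fun hA x) y
  have h3' (t) : g ∘ₗ T t = T t ∘ₗ g := by
    apply (LinearMap.toMatrix b b).injective
    rw [LinearMap.toMatrix_comp b b b, LinearMap.toMatrix_comp b b b, ← hg, h3]
  have hgg' : g ∘ₗ g' = LinearMap.id := by
    rw [← Matrix.toLin_mul, h1, Matrix.toLin_one]
  have hg'g : g' ∘ₗ g = LinearMap.id := by
    rw [← Matrix.toLin_mul, mul_eq_one_comm.mp h1, Matrix.toLin_one]
  exact ⟨{ g with
    map_lie' := h2'' _ _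
    invFun := g'
    left_inv := LinearMap.congr_fun hg'g
    right_inv := LinearMap.congr_fun hgg' }, fun _ ↦ rfl, fun t ↦ LinearMap.congr_fun (h3' t)⟩

/-- Let `V` be the common kernel of a family `T` of endomorphisms of `L`. If the Lie algebra of all
`y` such that `ad y` commutes with `T` maps onto `V` both under `⁅·, n⁆` and under `⁅·, n'⁆`, then
the elements `n` and `n'` of `V` are conjugate under an automorphism of `L` commuting with `T`. -/
theorem exists_lieEquiv_apply_eq [IsAlgClosed K] [CharZero K] [FiniteDimensional K L]
    {τ : Type*} [Fintype τ] (T : τ → End K L) {n n' : L} (hn : ∀ t, T t n = 0)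
    (hn' : ∀ t, T t n' = 0)
    (hV : ∀ v, (∀ t, T t v = 0) → ∃ y, (∀ t, (ad K L y : End K L) * T t = T t * ad K L y)
    ∧ ⁅y, n⁆ = v)
    (hV' : ∀ v, (∀ t, T t v = 0) →
      ∃ y, (∀ t, (ad K L y : End K L) * T t = T t * ad K L y) ∧ ⁅y, n'⁆ = v) :
    ∃ g : L ≃ₗ⁅K⁆ L, g n = n' ∧ ∀ t x, g (T t x) = T t (g x) := by
  classical
  let b := finBasis K L
  let P := LinearMap.pi T
  let V := LinearMap.ker P
  have hmem (v) : v ∈ V ↔ ∀ t, T t v = 0 := by simp [V, P, funext_iff]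
  let bV := finBasis K V
  obtain ⟨p, hp⟩ := V.subtype.exists_leftInverse_of_injective V.ker_subtype
  obtain ⟨C, hC⟩ : ∃ C : (τ → L) →ₗ[K] L, C ∘ₗ P = LinearMap.id - V.subtype ∘ₗ p := by
    obtain ⟨ℓ, hℓ⟩ := (V.liftQ P le_rfl).exists_leftInverse_of_injective
      (V.ker_liftQ_eq_bot _ _ le_rfl)
    refine ⟨V.liftQ (LinearMap.id - V.subtype ∘ₗ p) ?_ ∘ₗ ℓ, ?_⟩
    · intro v hv
      have := LinearMap.congr_fun hp ⟨v, hv⟩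
      simp at this
      simp [this]
    · ext x
      have := LinearMap.congr_fun hℓ (V.mkQ x)
      simp at this
      simp [this]
  let D i := LinearMap.toMatrix b b (ad K L (b i))
  let N t := LinearMap.toMatrix b b (T t)
  let Vm := LinearMap.toMatrix bV b V.subtype
  let Λ := LinearMap.toMatrix b bV p
  let Cm t := LinearMap.toMatrix b b (C ∘ₗ LinearMap.single K (fun _ ↦ L) t)
  have hΛV : Λ * Vm = 1 := by
    rw [← LinearMap.toMatrix_comp, hp, LinearMap.toMatrix_id]
  have hNV t : N t * Vm = 0 := by
    rw [← LinearMap.toMatrix_comp]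
    have : T t ∘ₗ V.subtype = 0 := LinearMap.ext fun v ↦ (hmem v).mp v.2 t
    rw [this, map_zero]
  have hVΛ : Vm * Λ = 1 - ∑ t, Cm t * N t := by
    have h1 : V.subtype ∘ₗ p = LinearMap.id - ∑ t, (C ∘ₗ LinearMap.single K (fun _ ↦ L) t)
        ∘ₗ T t := by
      rw [eq_sub_iff_add_eq', ← eq_sub_iff_add_eq, ← hC]
      ext x
      simp only [LinearMap.sum_apply, LinearMap.comp_apply, ← map_sum]
      congr 1
      ext t
      simp [P]
    simp only [Vm, Λ, Cm, N]
    rw [← LinearMap.toMatrix_comp, h1, map_sub, LinearMap.toMatrix_id, map_sum]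
    simp only [LinearMap.toMatrix_comp b b b]
  have hv j : ∀ t, T t (bV j) = 0 := (hmem _).mp (bV j).2
  have hD (y : L) (i) : LinearMap.toMatrix b b (ad K L y)
      * D i - D i * LinearMap.toMatrix b b (ad K L y)
      = ∑ k, LinearMap.toMatrix b b (ad K L y) k i • D k := by
    simp only [D]
    rw [← LinearMap.toMatrix_mul, ← LinearMap.toMatrix_mul, ← map_sub]
    have : (ad K L y : End K L) * ad K L (b i) - ad K L (b i) * ad K L y
        = ∑ k, LinearMap.toMatrix b b (ad K L y) k i • (ad K L (b k) : End K L) := by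
      have h1 : (ad K L y : End K L) * ad K L (b i) - ad K L (b i) * ad K L y
          = (ad K L : L →ₗ[K] End K L) ⁅y, b i⁆ := by
        ext z
        simp
      rw [h1, ← b.sum_repr ⁅y, b i⁆, map_sum]
      simp [LinearMap.toMatrix_apply]
    rw [this]
    simp
  have hN (y : L) (t) (h : (ad K L y : End K L) * T t = T t * ad K L y) :
      LinearMap.toMatrix b b (ad K L y) * N t = N t * LinearMap.toMatrix b b (ad K L y) := by
    simp only [N]
    rw [← LinearMap.toMatrix_mul, ← LinearMap.toMatrix_mul, h]
  have hNn (m : L) (hm : ∀ t, T t m = 0) t : N t *ᵥ b.repr m = 0 := by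
    simp [N, LinearMap.toMatrix_mulVec_repr, hm]
  have hY (y m : L) j (h : ⁅y, m⁆ = bV j) : LinearMap.toMatrix b b (ad K L y)
      *ᵥ b.repr m = Vm.col j := by
    rw [LinearMap.toMatrix_mulVec_repr]
    ext i
    simp [Vm, LinearMap.toMatrix_apply, h]
  choose y hy1 hy2 using fun j ↦ hV _ (hv j)
  choose y' hy1' hy2' using fun j ↦ hV' _ (hv j)
  obtain ⟨G₁, G₁', G₂, G₂', h1, h2, h3⟩ := exists_autDefect_eq_zero_mulVec_eq (D := D) hΛV hNV hVΛ
    (hNn n hn) (hNn n' hn') (fun j ↦ LinearMap.toMatrix b b (ad K L (y j)))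
    (fun j ↦ LinearMap.toMatrix b b (ad K L (y' j))) (fun j ↦ hD _) (fun j t ↦ hN _ _ (hy1 j t))
    (fun j ↦ hY _ _ _ (hy2 j)) (fun j ↦ hD _) (fun j t ↦ hN _ _ (hy1' j t))
    (fun j ↦ hY _ _ _ (hy2' j))
  obtain ⟨g₁, hg₁, hT₁⟩ := exists_lieEquiv_toLin_eq b T h1
  obtain ⟨g₂, hg₂, hT₂⟩ := exists_lieEquiv_toLin_eq b T h2
  have h4 : g₁ n = g₂ n' := by
    rw [hg₁, hg₂, Matrix.toLin_apply, Matrix.toLin_apply, h3]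
  refine ⟨g₁.trans g₂.symm, ?_, fun t x ↦ ?_⟩
  · rw [LieEquiv.trans_apply, h4, LieEquiv.symm_apply_apply]
  · apply g₂.injective
    change g₂ _ = g₂ _
    rw [hT₂]
    simp [hT₁]

end LieAlgebra

end

namespace LieAlgebra

variable {K L : Type*} [Field K] [IsAlgClosed K] [CharZero K] [LieRing L] [LieAlgebra K L]
  [FiniteDimensional K L] [IsSimple K L]

theorem exists_lieEquiv_eq_neg_of_isCartanSubalgebra (H : LieSubalgebra K L)
    [H.IsCartanSubalgebra] : ∃ θ : L ≃ₗ⁅K⁆ L, ∀ x ∈ H, θ x = -x := by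
  obtain ⟨b, ⟨B⟩⟩ := IsKilling.nonempty_basis H
  exact B.exists_lieEquiv_eq_neg

variable (K) in
theorem exists_lieEquiv_apply_eq_neg (x : L) : ∃ e : L ≃ₗ⁅K⁆ L, e x = -x := by
  obtain ⟨s, n, hx, hs, hn, hsy⟩ := exists_add_eq_isSemisimple_ad_isNilpotent_ad K x
  have hsn : ⁅s, n⁆ = 0 := by
    have : ⁅s, x⁆ = 0 := by simpa using hsy x 0 (by simp)
    rwa [← hx, lie_add, lie_self, zero_add] at this
  obtain ⟨h, f, hsh, hsf, hhn, hhf, hnf⟩ := exists_sl_two_triple_of_isNilpotent_ad hs hn hsn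
  obtain ⟨w, hwh, hw⟩ := exists_lieEquiv_lie_eq_two_smul hhn hhf hnf
  have hh := isSemisimple_ad_of_sl_two_triple hhn hhf hnf
  obtain ⟨H, hH, hsH, hhH⟩ := exists_isCartanSubalgebra_of_isSemisimple_ad hs hh hsh
  obtain ⟨θ, hθ⟩ := exists_lieEquiv_eq_neg_of_isCartanSubalgebra H
  obtain ⟨ψ, hψ⟩ : ∃ ψ : L ≃ₗ⁅K⁆ L, ∀ y, ψ y = w (θ y) := ⟨θ.trans w, fun _ ↦ rfl⟩
  have hψs : ψ s = -s := by rw [hψ, hθ s hsH, map_neg, hw s hsn hsf]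
  have hψh : ψ h = h := by rw [hψ, hθ h hhH, map_neg, hwh, neg_neg]
  let T (t : Bool) : Module.End K L := bif t then ad K L s else ad K L h - (2 : K) • 1
  have hT (v : L) : (∀ t, T t v = 0) ↔ ⁅s, v⁆ = 0 ∧ ⁅h, v⁆ = (2 : K) • v := by
    simp [T, sub_eq_zero, and_comm]
  have hcomm {y : L} (hsy : ⁅s, y⁆ = 0) (hhy : ⁅h, y⁆ = 0) (t : Bool) :
      (ad K L y : Module.End K L) * T t = T t * ad K L y := by
    have hc {a : L} (ha : ⁅a, y⁆ = 0) (z : L) : ⁅y, ⁅a, z⁆⁆ = ⁅a, ⁅y, z⁆⁆ := by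
      rw [leibniz_lie a, ha, zero_lie, zero_add]
    refine LinearMap.ext fun z ↦ ?_
    cases t
    · simp [T, -lie_lie, hc hhy]
    · exact hc hsy z
  have hV {v : L} (hv : ∀ t, T t v = 0) : ∃ m : L, ⁅s, m⁆ = 0 ∧ ⁅h, m⁆ = 0 ∧ ⁅n, m⁆ = v :=
    exists_lie_eq_of_lie_eq_two_smul hsn hsf hhn hhf hnf ((hT v).mp hv).1 ((hT v).mp hv).2
  have hψT {v : L} : (∀ t, T t (ψ v) = 0) ↔ ∀ t, T t v = 0 := by
    have hinj {a b : L} : ψ a = ψ b ↔ a = b := ψ.injective.eq_iff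
    have h₁ : ⁅s, ψ v⁆ = ψ (-⁅s, v⁆) := by rw [← neg_lie, LieEquiv.map_lie, map_neg, hψs, neg_neg]
    have h₂ : ⁅h, ψ v⁆ = ψ ⁅h, v⁆ := by rw [LieEquiv.map_lie, hψh]
    rw [hT, hT, h₁, h₂, ← map_smul, hinj, ← map_zero ψ, hinj, neg_eq_zero,
      map_zero]
  obtain ⟨g, hgn, hgT⟩ := exists_lieEquiv_apply_eq T (n := -ψ n) (n' := n)
    (fun t ↦ by
      rw [map_neg, hψT.mpr ((hT n).mpr ⟨hsn, hhn⟩), neg_zero]) ((hT n).mpr ⟨hsn, hhn⟩)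
    (fun v hv ↦ by
      obtain ⟨m, hsm, hhm, hm⟩ := hV (v := ψ.symm v) (hψT.mp (by simpa using hv))
      refine ⟨ψ m, hcomm ?_ ?_, ?_⟩
      · rw [← neg_eq_zero, ← neg_lie, ← hψs, ← LieEquiv.map_lie, hsm, map_zero]
      · rw [← hψh, ← LieEquiv.map_lie, hhm, map_zero]
      · rw [lie_neg, lie_skew, ← LieEquiv.map_lie, hm, LieEquiv.apply_symm_apply])
    (fun v hv ↦ by
      obtain ⟨m, hsm, hhm, hm⟩ := hV hv
      exact ⟨-m, hcomm (by rw [lie_neg, hsm, neg_zero]) (by rw [lie_neg, hhm, neg_zero]),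
        by rw [neg_lie, lie_skew, hm]⟩)
  have hgs : g s = s := by
    refine sub_eq_zero.mp ((LieDerivation.IsKilling.ad_apply_eq_zero_iff (R := K) L _).mp
      (LieDerivation.ext fun z ↦ ?_))
    have : g ⁅s, g.symm z⁆ = ⁅s, g (g.symm z)⁆ := hgT true (g.symm z)
    rw [LieEquiv.map_lie, LieEquiv.apply_symm_apply] at this
    simp [-lie_lie, this]
  refine ⟨ψ.trans g, ?_⟩
  change g (ψ x) = -x
  rw [← hx, map_add, map_add, hψs, map_neg, hgs, ← neg_neg (ψ n), map_neg, hgn, neg_add]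

omit [IsAlgClosed K] in
theorem eq_one_or_eq_neg_one_of_forall_exists_lieEquiv {c : K}
    (hc : ∀ x : L, ∃ e : L ≃ₗ⁅K⁆ L, c • x = e x) : c = 1 ∨ c = -1 := by
  obtain ⟨x, hx⟩ : ∃ x : L, killingForm K L x x ≠ 0 := by
    by_contra! h
    have hzero : killingForm K L = 0 := by
      refine LinearMap.ext₂ fun x y ↦ ?_
      have := h (x + y)
      rw [map_add, map_add, LinearMap.add_apply, LinearMap.add_apply, h, h,
        LieModule.traceForm_comm K L L y x] at this
      simpa [← two_mul] using this
    have := IsSimple.nontrivial K L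
    obtain ⟨x, hx⟩ := exists_ne (0 : L)
    exact hx ((IsKilling.killingForm_nondegenerate K L).1 x fun y ↦ by simp [hzero])
  obtain ⟨e, he⟩ := hc x
  have := killingForm_of_equiv_apply e x x
  rw [← he, map_smul, map_smul, LinearMap.smul_apply, smul_smul, smul_eq_mul] at this
  exact mul_self_eq_one_iff.mp (mul_right_cancel₀ hx (this.trans (one_mul _).symm))

end LieAlgebra

theorem scalar_isLocalAutomorphism_iff
    (K L : Type*) [Field K] [IsAlgClosed K] [CharZero K]
    [LieRing L] [LieAlgebra K L] [FiniteDimensional K L] [LieAlgebra.IsSimple K L]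
    (c : K) (hc : c ≠ 0) :
    IsLocalAutomorphism K L (c • (LinearMap.id : L →ₗ[K] L)) ↔ c = 1 ∨ c = -1 := by
  refine ⟨fun h ↦ LieAlgebra.eq_one_or_eq_neg_one_of_forall_exists_lieEquiv (L := L) h, ?_⟩
  rintro (rfl | rfl) x
  · exact ⟨LieEquiv.refl, by simp⟩
  · obtain ⟨e, he⟩ := LieAlgebra.exists_lieEquiv_apply_eq_neg K x
    exact ⟨e, by simp [he]⟩
end

section
/- Let g be a finite-dimensional simple Lie algebra over an algebraically closed field K of characteristic 0. Every local automorphism of g is a bijective linear map, the inverse of a local automorphism is a local automorphism, and the composite of two local automorphisms is a local automorphism; consequently the set LAut(g) of local automorphisms of g is a subgroup of GL(g). -/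
namespace IsLocalAutomorphism

variable {K L : Type*} [Field K] [LieRing L] [LieAlgebra K L] {φ ψ : L →ₗ[K] L}

theorem id : IsLocalAutomorphism K L LinearMap.id :=
  fun _ ↦ ⟨LieEquiv.refl, rfl⟩

theorem comp (hφ : IsLocalAutomorphism K L φ) (hψ : IsLocalAutomorphism K L ψ) :
    IsLocalAutomorphism K L (φ ∘ₗ ψ) := fun x ↦ by
  obtain ⟨e, he⟩ := hψ x
  obtain ⟨f, hf⟩ := hφ (ψ x)
  exact ⟨e.trans f, by rw [LinearMap.comp_apply, hf, he, LieEquiv.trans_apply]⟩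

theorem injective (hφ : IsLocalAutomorphism K L φ) : Function.Injective φ := by
  refine (injective_iff_map_eq_zero φ).2 fun x hx ↦ ?_
  obtain ⟨e, he⟩ := hφ x
  exact e.injective ((he.symm.trans hx).trans e.toLieHom.map_zero.symm)

theorem bijective [FiniteDimensional K L] (hφ : IsLocalAutomorphism K L φ) :
    Function.Bijective φ :=
  ⟨hφ.injective, LinearMap.injective_iff_surjective.1 hφ.injective⟩

theorem symm {e : L ≃ₗ[K] L} (he : IsLocalAutomorphism K L (e : L →ₗ[K] L)) :
    IsLocalAutomorphism K L (e.symm : L →ₗ[K] L) := fun y ↦ by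
  obtain ⟨f, hf⟩ := he (e.symm y)
  have h : y = f (e.symm y) := by simpa using hf
  exact ⟨f.symm, f.injective (h.symm.trans (f.apply_symm_apply y).symm)⟩

end IsLocalAutomorphism

theorem localAutomorphisms_form_subgroup
    (K L : Type*) [Field K] [IsAlgClosed K] [CharZero K]
    [LieRing L] [LieAlgebra K L] [FiniteDimensional K L] [LieAlgebra.IsSimple K L] :
    -- every local automorphism is bijective, and it has a (linear) inverse which is
    -- again a local automorphism
    (∀ φ : L →ₗ[K] L, IsLocalAutomorphism K L φ →
      Function.Bijective φ ∧
      ∃ ψ : L →ₗ[K] L, ψ ∘ₗ φ = LinearMap.id ∧ φ ∘ₗ ψ = LinearMap.id ∧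
        IsLocalAutomorphism K L ψ) ∧
    -- the composite of two local automorphisms is a local automorphism
    (∀ φ ψ : L →ₗ[K] L, IsLocalAutomorphism K L φ → IsLocalAutomorphism K L ψ →
      IsLocalAutomorphism K L (φ ∘ₗ ψ)) ∧
    -- consequently, the local automorphisms form a subgroup of GL(L)
    (∃ H : Subgroup (L ≃ₗ[K] L),
      ∀ e : L ≃ₗ[K] L, e ∈ H ↔ IsLocalAutomorphism K L (e : L →ₗ[K] L)) := by
  refine ⟨fun φ hφ ↦ ⟨hφ.bijective, ?_⟩, fun φ ψ hφ hψ ↦ hφ.comp hψ, ?_⟩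
  · obtain ⟨e, rfl⟩ : ∃ e : L ≃ₗ[K] L, (e : L →ₗ[K] L) = φ :=
      ⟨LinearEquiv.ofBijective φ hφ.bijective, rfl⟩
    exact ⟨e.symm, e.symm_comp, e.comp_symm, hφ.symm⟩
  · exact ⟨{ carrier := {e | IsLocalAutomorphism K L (e : L →ₗ[K] L)}
             one_mem' := .id
             mul_mem' := fun he hf ↦ he.comp hf
             inv_mem' := fun he ↦ he.symm }, fun _ ↦ Iff.rfl⟩
end

section
/- Let g be a finite-dimensional semisimple Lie algebra over an algebraically closed field K of characteristic 0. If V is a nilpotent subspace of g, then dim V ≤ (dim g − rank g)/2. -/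
open LieAlgebra LieModule Module

universe u

/-- A rational vector space embeds, as a group, in a linearly ordered abelian group. -/
lemma exists_injective_addMonoidHom_isOrderedAddMonoid (E : Type u) [AddCommGroup E] [Module ℚ E] :
    ∃ (Γ : Type u) (_ : AddCommGroup Γ) (_ : LinearOrder Γ) (_ : IsOrderedAddMonoid Γ)
      (φ : E →+ Γ), Function.Injective φ := by
  classical
  let b := Basis.ofVectorSpace ℚ E
  let _ : LinearOrder (Basis.ofVectorSpaceIndex ℚ E) := linearOrderOfSTO WellOrderingRel
  refine ⟨Lex (Basis.ofVectorSpaceIndex ℚ E →₀ ℚ), inferInstance, inferInstance, inferInstance,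
    { toFun := fun x ↦ toLex (b.repr x), map_zero' := ?_, map_add' := ?_ }, ?_⟩
  · simp
  · intro x y
    simp
  · exact toLex.injective.comp b.repr.injective

section Upper

variable {K L : Type*} [Field K] [LieRing L] [LieAlgebra K L] {H : LieSubalgebra K L}
  [H.IsCartanSubalgebra] {Γ : Type*} [AddCommGroup Γ] [LinearOrder Γ]

/-- The sum of the root spaces of degree strictly greater than `γ`, where the degree of a
weight is given by `φ`. -/
def upperRootSpace (φ : (H → K) →+ Γ) (γ : Γ) : LieSubmodule K H L :=
  ⨆ χ : {χ : H → K // γ < φ χ}, rootSpace H χ.1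

lemma mem_upperRootSpace_of_mem_rootSpace (φ : (H → K) →+ Γ) {γ : Γ} {χ : H → K} (h : γ < φ χ)
    {x : L} (hx : x ∈ rootSpace H χ) : x ∈ upperRootSpace φ γ :=
  LieSubmodule.mem_iSup_of_mem (N := fun χ : {χ : H → K // γ < φ χ} ↦ rootSpace H χ.1) ⟨χ, h⟩ hx

lemma lie_mem_upperRootSpace_of_mem_rootSpace [IsOrderedAddMonoid Γ] (φ : (H → K) →+ Γ) {γ : Γ}
    {χ : H → K} {x e : L} (hx : x ∈ upperRootSpace φ γ) (he : e ∈ rootSpace H χ) :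
    ⁅x, e⁆ ∈ upperRootSpace φ (γ + φ χ) := by
  refine LieSubmodule.iSup_induction _ (motive := fun x ↦ ⁅x, e⁆ ∈ upperRootSpace φ (γ + φ χ)) hx ?_ ?_ ?_
  · intro ψ y hy
    refine mem_upperRootSpace_of_mem_rootSpace φ (χ := ψ.1 + χ) ?_
      (lie_mem_genWeightSpace_of_mem_genWeightSpace hy he)
    rw [map_add]
    exact add_lt_add_left ψ.2 _
  · simp
  · intro y z hy hz
    rw [add_lie]
    exact add_mem hy hz

lemma lie_mem_upperRootSpace [IsOrderedAddMonoid Γ] (φ : (H → K) →+ Γ) {γ : Γ}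
    {x y : L} (hx : x ∈ upperRootSpace φ 0) (hy : y ∈ upperRootSpace φ γ) :
    ⁅x, y⁆ ∈ upperRootSpace φ γ := by
  refine LieSubmodule.iSup_induction _ (motive := fun y ↦ ⁅x, y⁆ ∈ upperRootSpace φ γ) hy ?_ ?_ ?_
  · intro ψ z hz
    have hxz := lie_mem_upperRootSpace_of_mem_rootSpace φ hx hz
    rw [zero_add] at hxz
    refine LieSubmodule.iSup_induction _ (motive := (· ∈ upperRootSpace φ γ)) hxz ?_ (zero_mem _) fun _ _ ↦ add_mem
    intro ξ w hw
    exact mem_upperRootSpace_of_mem_rootSpace φ (ψ.2.trans ξ.2) hw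
  · simp
  · intro y z hy hz
    rw [lie_add]
    exact add_mem hy hz

lemma eq_zero_of_mem_rootSpace_of_mem_upperRootSpace (φ : (H → K) →+ Γ) {χ : H → K} {x : L}
    (hx : x ∈ rootSpace H χ) (hx' : x ∈ upperRootSpace φ (φ χ)) : x = 0 := by
  have hd := iSupIndep_genWeightSpace K H L χ
  refine (LieSubmodule.mem_bot x).mp (hd.le_bot ⟨hx, ?_⟩)
  refine (iSup_le fun ψ ↦ ?_ : upperRootSpace φ (φ χ) ≤ _) hx'
  exact le_iSup₂_of_le ψ.1 (fun h ↦ ψ.2.ne (by rw [h])) le_rfl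

end Upper

section Killing

variable {K L : Type*} [Field K] [IsAlgClosed K] [CharZero K] [LieRing L] [LieAlgebra K L]
  [FiniteDimensional K L] [IsKilling K L] {H : LieSubalgebra K L} [H.IsCartanSubalgebra]

/-- If the sum of an element of a Cartan subalgebra and of an element of strictly positive degree
is nilpotent, then the former vanishes. -/
lemma eq_zero_of_isNilpotent_ad_add_mem_upperRootSpace {Γ : Type*} [AddCommGroup Γ]
    [LinearOrder Γ] [IsOrderedAddMonoid Γ] (φ : (H → K) →+ Γ) {h u : L} (hh : h ∈ H)
    (hu : u ∈ upperRootSpace φ 0) (hn : IsNilpotent (ad K L (h + u))) : h = 0 := by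
  suffices had : ad K L h = 0 from
    IsKilling.eq_zero_of_isNilpotent_ad_of_mem_isCartanSubalgebra K L H hh (had ▸ .zero)
  obtain ⟨n, hn⟩ := hn
  ext y
  have hy : y ∈ ⨆ χ, rootSpace H χ := by simp [iSup_genWeightSpace_eq_top K H L]
  refine LieSubmodule.iSup_induction _ (motive := fun y ↦ ad K L h y = (0 : End K L) y) hy ?_ (by simp) ?_
  · intro χ e he
    have lie_h {z : L} (hz : z ∈ rootSpace H χ) : ⁅h, z⁆ = χ ⟨h, hh⟩ • z :=
      IsKilling.lie_eq_smul_of_mem_rootSpace hz ⟨h, hh⟩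
    have key (m : ℕ) : (ad K L (h + u) ^ m) e - χ ⟨h, hh⟩ ^ m • e ∈ upperRootSpace φ (φ χ) := by
      induction m with
      | zero => simp
      | succ m ih =>
        set w := (ad K L (h + u) ^ m) e - χ ⟨h, hh⟩ ^ m • e with hw
        have hw' : (ad K L (h + u) ^ m) e = χ ⟨h, hh⟩ ^ m • e + w := by simp [hw]
        have hue := lie_mem_upperRootSpace_of_mem_rootSpace φ hu he
        rw [zero_add] at hue
        have hhw : ⁅h, w⁆ ∈ upperRootSpace φ (φ χ) :=
          LieSubmodule.lie_mem (x := (⟨h, hh⟩ : H)) _ ih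
        have : (ad K L (h + u) ^ (m + 1)) e - χ ⟨h, hh⟩ ^ (m + 1) • e =
            χ ⟨h, hh⟩ ^ m • ⁅u, e⁆ + (⁅h, w⁆ + ⁅u, w⁆) := by
          rw [pow_succ', Module.End.mul_apply, hw', ad_apply, add_lie, lie_add, lie_add, lie_smul,
            lie_smul, lie_h he, smul_smul, ← pow_succ]
          abel
        rw [this]
        exact add_mem (SMulMemClass.smul_mem _ hue) (add_mem hhw (lie_mem_upperRootSpace φ hu ih))
    have hz : χ ⟨h, hh⟩ ^ n • e = 0 := by
      refine eq_zero_of_mem_rootSpace_of_mem_upperRootSpace φ (SMulMemClass.smul_mem _ he) ?_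
      have hk := key n
      rw [hn] at hk
      simpa using hk
    rw [ad_apply, lie_h he]
    rcases smul_eq_zero.mp hz with h0 | h0
    · simp [eq_zero_of_pow_eq_zero h0]
    · simp [h0]
  · intro y z hy hz
    rw [map_add, hy, hz]
    simp

/-- Root vectors of opposite weights pair nontrivially under the Killing form. -/
lemma killingForm_ne_zero_of_mem_rootSpace_of_mem_rootSpace_neg {α : Weight K H L}
    (hα : α.IsNonZero) {x y : L} (hx : x ∈ rootSpace H α) (hy : y ∈ rootSpace H (-α)) (hx0 : x ≠ 0)
    (hy0 : y ≠ 0) : killingForm K L x y ≠ 0 := by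
  intro hxy
  refine hx0 ?_
  have hker := mem_ker_killingForm_of_mem_rootSpace_of_forall_rootSpace_neg K L H hx fun z hz ↦ ?_
  · rwa [IsKilling.ker_killingForm_eq_bot, Submodule.mem_bot] at hker
  · have h1 : finrank K (rootSpace H (-α : Weight K H L)) = 1 :=
      IsKilling.finrank_rootSpace_eq_one (-α) (by simpa using hα)
    obtain ⟨c, hc⟩ := (finrank_eq_one_iff_of_nonzero'
      (⟨y, hy⟩ : rootSpace H (-α : Weight K H L)) (by simpa using hy0)).mp h1 ⟨z, hz⟩
    obtain rfl : c • y = z := congrArg Subtype.val hc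
    rw [map_smul, hxy, smul_zero]

/-- Two elements with opposite nonzero leading weights pair nontrivially under the Killing form. -/
lemma killingForm_ne_zero_of_leading {Γ : Type*} [AddCommGroup Γ]
    [LinearOrder Γ] [IsOrderedAddMonoid Γ] {φ : (H → K) →+ Γ} (hφ : Function.Injective φ)
    {a b : Weight K H L → L}
    (ha : ∀ χ : Weight K H L, a χ ∈ rootSpace H χ) (hb : ∀ χ : Weight K H L, b χ ∈ rootSpace H χ)
    {α : Weight K H L} (hα : α.IsNonZero) (haα : a α ≠ 0) (hbα : b (-α) ≠ 0)
    (hla : ∀ χ : Weight K H L, a χ ≠ 0 → φ α ≤ φ χ)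
    (hlb : ∀ χ : Weight K H L, b χ ≠ 0 → φ (-α) ≤ φ χ) :
    killingForm K L (∑ χ, a χ) (∑ χ, b χ) ≠ 0 := by
  have hsum : killingForm K L (∑ χ, a χ) (∑ χ, b χ) = killingForm K L (a α) (b (-α)) := by
    have hzero (χ ψ : Weight K H L) (h : ¬ (χ = α ∧ ψ = -α)) :
        killingForm K L (a χ) (b ψ) = 0 := by
      by_cases hχψ : (χ : H → K) + ψ = 0
      · by_contra hne
        have h1 : a χ ≠ 0 := fun h ↦ hne (by simp [h])
        have h2 : b ψ ≠ 0 := fun h ↦ hne (by simp [h])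
        have hψ : (ψ : H → K) = -χ := (neg_eq_of_add_eq_zero_right hχψ).symm
        have h3 := hlb ψ h2
        rw [hψ, map_neg, map_neg, neg_le_neg_iff] at h3
        have h4 : (χ : H → K) = α := hφ (le_antisymm h3 (hla χ h1))
        refine h ⟨DFunLike.coe_injective h4, DFunLike.coe_injective ?_⟩
        rw [hψ, h4, LieModule.Weight.coe_neg]
      · exact killingForm_apply_eq_zero_of_mem_rootSpace_of_add_ne_zero K L H (ha χ) (hb ψ) hχψ
    simp only [map_sum, LinearMap.sum_apply]
    rw [Finset.sum_eq_single (-α), Finset.sum_eq_single α]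
    · exact fun χ _ hχ ↦ hzero _ _ fun h ↦ hχ h.1
    · simp
    · exact fun ψ _ hψ ↦ Finset.sum_eq_zero fun χ _ ↦ hzero _ _ fun h ↦ hψ h.2
    · simp
  rw [hsum]
  exact killingForm_ne_zero_of_mem_rootSpace_of_mem_rootSpace_neg hα (ha α) (hb (-α)) haα hbα

variable (K L H) in
omit [CharZero K] [IsKilling K L] in
lemma exists_rootSpace_equiv [DecidableEq (Weight K H L)] :
    ∃ e : (DirectSum (Weight K H L) fun χ ↦ (rootSpace H χ).toSubmodule) ≃ₗ[K] L,
      ∀ z, e z = ∑ χ, (z χ : L) := by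
  have hI : DirectSum.IsInternal fun χ : Weight K H L ↦ (rootSpace H χ).toSubmodule := by
    rw [DirectSum.isInternal_submodule_iff_iSupIndep_and_iSup_eq_top]
    refine ⟨LieSubmodule.iSupIndep_toSubmodule.mpr (iSupIndep_genWeightSpace' K H L), ?_⟩
    rw [← LieSubmodule.iSup_toSubmodule, iSup_genWeightSpace_eq_top' K H L]
    simp
  refine ⟨LinearEquiv.ofBijective (DirectSum.coeLinearMap _) hI, fun z ↦ ?_⟩
  classical
  change DirectSum.coeLinearMap _ z = _
  rw [DirectSum.coeLinearMap_eq_dfinsuppSum,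
    DFinsupp.sum_eq_sum_fintype _ (by simp)]
  rfl

variable (K L H) in
omit [CharZero K] [IsKilling K L] in
lemma exists_rootSpace_components :
    ∃ p : (χ : Weight K H L) → L →ₗ[K] (rootSpace H χ).toSubmodule,
      ∀ x, ∑ χ, (p χ x : L) = x := by
  classical
  obtain ⟨e, he⟩ := exists_rootSpace_equiv K L H
  exact ⟨fun χ ↦ DirectSum.component K _ _ χ ∘ₗ e.symm.toLinearMap,
    fun x ↦ (he (e.symm x)).symm.trans (e.apply_symm_apply x)⟩

/-- A set of roots containing no pair of opposite roots has at most `(dim L - dim H) / 2`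
elements. -/
lemma two_mul_card_add_finrank_le (S : Finset (Weight K H L)) (hS : ∀ α ∈ S, α.IsNonZero)
    (hS' : ∀ α ∈ S, -α ∉ S) : 2 * S.card + finrank K H ≤ finrank K L := by
  classical
  obtain ⟨e, -⟩ := exists_rootSpace_equiv K L H
  have hL : finrank K L = ∑ χ : Weight K H L, finrank K (rootSpace H χ) := by
    rw [← e.finrank_eq, finrank_directSum]
    rfl
  have hcard : 2 * S.card = (S ∪ S.image (fun α ↦ -α)).card := by
    rw [Finset.card_union_of_disjoint, Finset.card_image_of_injective _ neg_injective, two_mul]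
    refine Finset.disjoint_left.mpr fun α hα hα' ↦ ?_
    obtain ⟨β, hβ, rfl⟩ := Finset.mem_image.mp hα'
    exact hS' β hβ hα
  have hnz : ∀ α ∈ S ∪ S.image (fun α ↦ -α), α.IsNonZero := by
    intro α hα
    rcases Finset.mem_union.mp hα with hα | hα
    · exact hS α hα
    · obtain ⟨β, hβ, rfl⟩ := Finset.mem_image.mp hα
      simpa using hS β hβ
  have hroots : 2 * S.card =
      ∑ χ ∈ S ∪ S.image (fun α ↦ -α), finrank K (rootSpace H χ) := by
    rw [hcard, Finset.card_eq_sum_ones]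
    exact Finset.sum_congr rfl fun χ hχ ↦ (IsKilling.finrank_rootSpace_eq_one χ (hnz χ hχ)).symm
  rcases subsingleton_or_nontrivial H with hH | hH
  · rw [finrank_zero_of_subsingleton, add_zero, hroots, hL]
    exact Finset.sum_le_sum_of_subset (Finset.subset_univ _)
  · have h0 : finrank K H = finrank K (rootSpace H (0 : Weight K H L)) := by
      rw [FunLike.coe_zero, rootSpace_zero_eq]
      rfl
    have hmem : (0 : Weight K H L) ∉ S ∪ S.image (fun α ↦ -α) := fun h ↦ hnz 0 h Weight.isZero_zero
    rw [h0, hroots, hL, add_comm,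
      ← Finset.sum_insert (f := fun χ : Weight K H L ↦ finrank K (rootSpace H χ)) hmem]
    exact Finset.sum_le_sum_of_subset (Finset.subset_univ _)

end Killing

theorem nilpotent_subspace_dim_le
    (K L : Type*) [Field K] [IsAlgClosed K] [CharZero K]
    [LieRing L] [LieAlgebra K L] [FiniteDimensional K L] [LieAlgebra.IsSemisimple K L]
    (V : Submodule K L) (hV : ∀ x ∈ V, IsNilpotent (LieAlgebra.ad K L x))
    (H : LieSubalgebra K L) (hH : H.IsCartanSubalgebra) :
    2 * Module.finrank K V + Module.finrank K H ≤ Module.finrank K L := by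
  classical
  obtain ⟨Γ, _, _, _, φ, hφ⟩ := exists_injective_addMonoidHom_isOrderedAddMonoid (H → K)
  obtain ⟨p, hp⟩ := exists_rootSpace_components K L H
  have isotropic : ∀ x ∈ V, ∀ y ∈ V, killingForm K L x y = 0 := by
    have hsq : ∀ x ∈ V, killingForm K L x x = 0 := by
      intro x hx
      rw [killingForm_apply_apply]
      exact (LinearMap.isNilpotent_trace_of_isNilpotent
        ((Commute.refl (ad K L x)).isNilpotent_mul_right (hV x hx))).eq_zero
    intro x hx y hy
    have h := hsq (x + y) (add_mem hx hy)
    rw [map_add, map_add, LinearMap.add_apply, LinearMap.add_apply, hsq x hx, hsq y hy,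
      LieModule.traceForm_comm K L L y x] at h
    simpa using h
  let lead (v : L) (α : Weight K H L) : Prop :=
    p α v ≠ 0 ∧ ∀ χ : Weight K H L, p χ v ≠ 0 → φ α ≤ φ χ
  have exists_lead (v : L) (hv : v ≠ 0) : ∃ α, lead v α := by
    have hne : (Finset.univ.filter fun χ : Weight K H L ↦ p χ v ≠ 0).Nonempty := by
      by_contra hne
      refine hv ?_
      rw [← hp v]
      refine Finset.sum_eq_zero fun χ _ ↦ ?_
      rw [Finset.not_nonempty_iff_eq_empty, Finset.filter_eq_empty_iff] at hne
      simpa using hne (Finset.mem_univ χ)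
    obtain ⟨α, hα, hmin⟩ := Finset.exists_min_image _ (fun χ : Weight K H L ↦ φ χ) hne
    exact ⟨α, (Finset.mem_filter.mp hα).2, fun χ hχ ↦ hmin χ (by simpa using hχ)⟩
  let S : Finset (Weight K H L) := Finset.univ.filter fun α ↦ ∃ v ∈ V, lead v α
  have hS : ∀ α ∈ S, α.IsNonZero := by
    intro α hα hα0
    obtain ⟨v, hv, hαv, hmin⟩ := (Finset.mem_filter.mp hα).2
    have hα0' : (α : H → K) = 0 := hα0
    have hh : (p α v : L) ∈ H := by
      have hle : rootSpace H α ≤ H.toLieSubmodule := by rw [hα0', rootSpace_zero_eq]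
      exact hle (p α v).2
    have hu : ∑ χ ∈ Finset.univ.erase α, (p χ v : L) ∈ upperRootSpace φ 0 := by
      refine sum_mem fun χ hχ ↦ ?_
      by_cases h0 : p χ v = 0
      · simp [h0]
      refine mem_upperRootSpace_of_mem_rootSpace φ ?_ (p χ v).2
      have hle := hmin χ h0
      refine lt_of_le_of_ne (by simpa [hα0'] using hle) fun h ↦ Finset.ne_of_mem_erase hχ ?_
      refine DFunLike.coe_injective (hφ ?_)
      rw [← h, hα0', map_zero]
    have hsum : (p α v : L) + ∑ χ ∈ Finset.univ.erase α, (p χ v : L) = v := by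
      rw [Finset.add_sum_erase _ (fun χ ↦ (p χ v : L)) (Finset.mem_univ α), hp]
    have := eq_zero_of_isNilpotent_ad_add_mem_upperRootSpace φ hh hu (by rw [hsum]; exact hV v hv)
    exact hαv (by simpa using this)
  have hS' : ∀ α ∈ S, -α ∉ S := by
    intro α hα hα'
    obtain ⟨v, hv, hαv, hminv⟩ := (Finset.mem_filter.mp hα).2
    obtain ⟨w, hw, hαw, hminw⟩ := (Finset.mem_filter.mp hα').2
    refine killingForm_ne_zero_of_leading hφ (a := fun χ ↦ p χ v) (b := fun χ ↦ p χ w)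
      (fun χ ↦ (p χ v).2) (fun χ ↦ (p χ w).2) (hS α hα) (by simpa using hαv) (by simpa using hαw)
      (fun χ h ↦ hminv χ (by simpa using h)) (fun χ h ↦ by simpa using hminw χ (by simpa using h))
      ?_
    rw [hp, hp]
    exact isotropic v hv w hw
  have hVS : finrank K V ≤ S.card := by
    let f : V →ₗ[K] (α : S) → (rootSpace H α.1).toSubmodule :=
      LinearMap.pi fun α ↦ p α.1 ∘ₗ V.subtype
    have hf : Function.Injective f := by
      refine (injective_iff_map_eq_zero f).mpr fun v hv ↦ ?_
      by_contra hv0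
      obtain ⟨α, hα⟩ := exists_lead v (by simpa using hv0)
      exact hα.1 (congrFun hv ⟨α, by simpa [S] using ⟨v.1, v.2, hα⟩⟩)
    refine (LinearMap.finrank_le_finrank_of_injective hf).trans_eq ?_
    rw [finrank_pi_fintype, ← Fintype.card_coe, Fintype.card, Finset.card_eq_sum_ones]
    exact Finset.sum_congr rfl fun α _ ↦ IsKilling.finrank_rootSpace_eq_one α.1 (hS α.1 α.2)
  exact (by lia : 2 * finrank K V + finrank K H ≤ 2 * S.card + finrank K H).trans
    (two_mul_card_add_finrank_le S hS hS')
end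

section
/- Let g be a finite-dimensional simple Lie algebra over an algebraically closed field K of characteristic 0. For every nilpotent element e ∈ g there exists a Lie algebra automorphism α of g such that α(e) = −e. -/
open Module

section Grading

variable {ι R L : Type*} [DecidableEq ι] [CommRing R]

/-- A family of scalars on an internal direct sum is realised by a linear endomorphism. -/
theorem DirectSum.IsInternal.exists_end_apply_eq_smul {M : Type*} [AddCommGroup M] [Module R M]
    {A : ι → Submodule R M} (hA : DirectSum.IsInternal A) (c : ι → R) :
    ∃ T : End R M, ∀ i, ∀ x ∈ A i, T x = c i • x := by
  let E := LinearEquiv.ofBijective (DirectSum.coeLinearMap A) hA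
  refine ⟨DirectSum.toModule R ι M (fun i ↦ c i • (A i).subtype) ∘ₗ E.symm.toLinearMap,
    fun i x hx ↦ ?_⟩
  have hE : E.symm x = DirectSum.lof R ι (fun i ↦ A i) i ⟨x, hx⟩ := by
    rw [LinearEquiv.symm_apply_eq]
    exact (DirectSum.coeLinearMap_lof A i ⟨x, hx⟩).symm
  simp [hE]

variable [LieRing L] [LieAlgebra R L]

/-- A character of the grading group of a graded Lie algebra acts by an automorphism. -/
theorem LieAlgebra.exists_lieEquiv_apply_eq_smul [AddCommGroup ι] {A : ι → Submodule R L}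
    (hA : DirectSum.IsInternal A)
    (hlie : ∀ i j, ∀ x ∈ A i, ∀ y ∈ A j, ⁅x, y⁆ ∈ A (i + j)) (χ : ι →+ Additive Rˣ) :
    ∃ α : L ≃ₗ⁅R⁆ L, ∀ i, ∀ x ∈ A i, α x = (χ i).toMul • x := by
  obtain ⟨T, hT⟩ := hA.exists_end_apply_eq_smul fun i ↦ ((χ i).toMul : R)
  obtain ⟨S, hS⟩ := hA.exists_end_apply_eq_smul fun i ↦ (((χ i).toMul⁻¹ : Rˣ) : R)
  have htop (x : L) : x ∈ ⨆ i, A i := by simp [hA.submodule_iSup_eq_top]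
  have hST : S ∘ₗ T = LinearMap.id := by
    ext x
    induction htop x using Submodule.iSup_induction' with
    | mem i x hx => simp [hT i x hx, hS i x hx, smul_smul]
    | zero => simp
    | add x y _ _ hx hy => rw [map_add, map_add, hx, hy]
  have hTS : T ∘ₗ S = LinearMap.id := by
    ext x
    induction htop x using Submodule.iSup_induction' with
    | mem i x hx => simp [hT i x hx, hS i x hx, smul_smul]
    | zero => simp
    | add x y _ _ hx hy => rw [map_add, map_add, hx, hy]
  have hTlie (x y : L) : T ⁅x, y⁆ = ⁅T x, T y⁆ := by
    induction htop x using Submodule.iSup_induction' with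
    | zero => simp
    | add x x' _ _ hx hx' => simp [hx, hx']
    | mem i x hx =>
      induction htop y using Submodule.iSup_induction' with
      | zero => simp
      | add y y' _ _ hy hy' => simp [hy, hy']
      | mem j y hy =>
        rw [hT _ _ (hlie i j x hx y hy), hT i x hx, hT j y hy]
        simp [smul_smul, mul_comm]
  let E : L ≃ₗ[R] L := LinearEquiv.ofLinearMap T S hTS hST
  exact ⟨{ E with map_lie' := hTlie _ _ }, hT⟩

end Grading

/-- Over an algebraically closed field of characteristic zero, every nonzero scalar is the value
at `1` of a character of the additive group of the field. -/
theorem IsAlgClosed.exists_addMonoidHom_one_eq (K : Type*) [Field K] [IsAlgClosed K] [CharZero K]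
    (u : Kˣ) : ∃ χ : K →+ Additive Kˣ, χ 1 = Additive.ofMul u := by
  have hroot {n : ℕ} (hn : n ≠ 0) : Function.Surjective (fun a : Kˣ ↦ a ^ n) := fun a ↦ by
    obtain ⟨z, hz⟩ := IsAlgClosed.exists_pow_nat_eq (a : K) (Nat.pos_of_ne_zero hn)
    have hz0 : z ≠ 0 := by
      rintro rfl
      exact a.ne_zero (by rw [← hz, zero_pow hn])
    exact ⟨Units.mk0 z hz0, Units.ext (by simpa using hz)⟩
  let _ : RootableBy Kˣ ℕ := rootableByOfPowLeftSurj Kˣ ℕ hroot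
  let _ : RootableBy Kˣ ℤ := Group.rootableByIntOfRootableByNat Kˣ
  let _ : DivisibleBy (Additive Kˣ) ℤ :=
    { div := fun a n ↦ Additive.ofMul (RootableBy.root a.toMul n)
      div_zero := fun a ↦ congrArg Additive.ofMul (RootableBy.root_zero a.toMul)
      div_cancel := fun a hn ↦ congrArg Additive.ofMul (RootableBy.root_cancel a.toMul hn) }
  obtain ⟨χ, hχ⟩ := (Module.Baer.of_divisible (Additive Kˣ)).extension_property_addMonoidHom
    (Int.castAddHom K) Int.cast_injective (zmultiplesHom _ (Additive.ofMul u))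
  exact ⟨χ, by simpa using DFunLike.congr_fun hχ 1⟩

/-- In a Lie algebra with nondegenerate Killing form, an ad-nilpotent element `e` lies in the
range of `ad e`. -/
theorem LieAlgebra.exists_lie_eq_self_of_isNilpotent_ad {K L : Type*} [Field K] [LieRing L]
    [LieAlgebra K L] [FiniteDimensional K L] [LieAlgebra.IsKilling K L] {e : L}
    (he : IsNilpotent (LieAlgebra.ad K L e)) : ∃ h : L, ⁅h, e⁆ = e := by
  have hnd := LieAlgebra.IsKilling.killingForm_nondegenerate K L
  have hrefl := (LieModule.traceForm_isSymm K L L).isRefl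
  suffices e ∈ LinearMap.range (LieAlgebra.ad K L e) by
    obtain ⟨h, hh⟩ := this
    exact ⟨-h, by rw [neg_lie, lie_skew]; exact hh⟩
  rw [← LinearMap.BilinForm.orthogonal_orthogonal hnd hrefl (LinearMap.range _)]
  intro z hz
  have hez : ⁅e, z⁆ = 0 := by
    refine hnd.2 _ fun x ↦ ?_
    have := hz ⁅e, x⁆ ⟨x, rfl⟩
    rw [LieModule.traceForm_apply_lie_apply'] at this
    exact neg_eq_zero.mp this
  have hcomm : Commute (LieAlgebra.ad K L e) (LieAlgebra.ad K L z) := by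
    refine LinearMap.ext fun x ↦ ?_
    simp [leibniz_lie e z x, hez]
  exact (LinearMap.isNilpotent_trace_of_isNilpotent (hcomm.symm.isNilpotent_mul_left he)).eq_zero

theorem exists_automorphism_neg_of_nilpotent
    (K L : Type*) [Field K] [IsAlgClosed K] [CharZero K]
    [LieRing L] [LieAlgebra K L] [FiniteDimensional K L] [LieAlgebra.IsSimple K L]
    (e : L) (he : IsNilpotent (LieAlgebra.ad K L e)) :
    ∃ α : L ≃ₗ⁅K⁆ L, α e = -e := by
  classical
  obtain ⟨h, hh⟩ := LieAlgebra.exists_lie_eq_self_of_isNilpotent_ad he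
  obtain ⟨χ, hχ⟩ := IsAlgClosed.exists_addMonoidHom_one_eq K (-1)
  have hA : DirectSum.IsInternal (LieAlgebra.ad K L h).maxGenEigenspace :=
    DirectSum.isInternal_submodule_of_iSupIndep_of_iSup_eq_top
      (End.independent_maxGenEigenspace _) (End.iSup_maxGenEigenspace_eq_top _)
  obtain ⟨α, hα⟩ := LieAlgebra.exists_lieEquiv_apply_eq_smul hA
    (fun _ _ _ hx _ hy ↦ LieModule.lie_mem_maxGenEigenspace_toEnd hx hy) χ
  refine ⟨α, ?_⟩
  rw [hα 1 e ((LieAlgebra.ad K L h).mem_maxGenEigenspace 1 e |>.mpr ⟨1, by simp [hh]⟩), hχ]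
  simp
end

section
/- Let g be a finite-dimensional simple Lie algebra over an algebraically closed field K of characteristic 0. For every semisimple element s ∈ g there exists a Lie algebra automorphism α of g such that α(s) = −s. -/
section

open LieAlgebra LieAlgebra.IsKilling LieModule Module

theorem LieEquiv.symm_trans_apply_of_eq_s13 {R P L₁ L₂ : Type*} [CommRing R] [LieRing P] [LieRing L₁]
    [LieRing L₂] [LieAlgebra R P] [LieAlgebra R L₁] [LieAlgebra R L₂] (X : P ≃ₗ⁅R⁆ L₁)
    (Y : P ≃ₗ⁅R⁆ L₂) (w : P) {a : L₁} {c : L₂} (ha : X w = a) (hc : Y w = c) :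
    (X.symm.trans Y) a = c := by
  rw [← ha, LieEquiv.trans_apply, LieEquiv.symm_apply_apply, hc]

theorem LieAlgebra.Basis.equivOfReindex_h {ι₁ ι₂ L₁ L₂ K : Type*} [Finite ι₁] [Finite ι₂]
    (eι : ι₁ ≃ ι₂) [LieRing L₁] [LieRing L₂] [Field K] [CharZero K]
    [LieAlgebra K L₁] [FiniteDimensional K L₁] {H₁ : LieSubalgebra K L₁} (b₁ : Basis ι₁ H₁)
    [LieAlgebra K L₂] [FiniteDimensional K L₂] {H₂ : LieSubalgebra K L₂} (b₂ : Basis ι₂ H₂)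
    (hA : b₁.A.reindex eι eι = b₂.A) [IsSimple K L₁] [IsSimple K L₂] (i : ι₁) :
    b₁.equivOfReindex eι b₂ hA (b₁.h i) = b₂.h (eι i) := by
  unfold Basis.equivOfReindex
  exact LieEquiv.symm_trans_apply_of_eq_s13 _ _
    ⟨(b₁.h i, b₂.h (eι i)), LieSubalgebra.subset_lieSpan <| by aesop⟩ rfl rfl

/-- The Chevalley involution acts as `-1` on the Cartan subalgebra. -/
theorem LieAlgebra.Basis.exists_equiv_apply_eq_neg {ι L K : Type*} [Finite ι] [LieRing L] [Field K]
    [CharZero K] [LieAlgebra K L] [FiniteDimensional K L] [IsSimple K L]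
    {H : LieSubalgebra K L} (b : Basis ι H) :
    ∃ α : L ≃ₗ⁅K⁆ L, ∀ x ∈ H, α x = -x := by
  have hA : b.A.reindex (Equiv.refl ι) (Equiv.refl ι) = b.symm.A := by simp
  refine ⟨b.equivOfReindex (Equiv.refl ι) b.symm hA, fun x hx ↦ ?_⟩
  rw [← LieSubalgebra.mem_toSubmodule, b.coe_cartan_eq_span] at hx
  induction hx using Submodule.span_induction with
  | mem y hy =>
    obtain ⟨i, rfl⟩ := hy
    rw [equivOfReindex_h]
    rfl
  | zero => simp
  | add y z _ _ hy hz => rw [map_add, hy, hz, neg_add]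
  | smul t y _ hy => rw [map_smul, hy, smul_neg]

theorem lie_eq_zero_of_lie_lie_eq_zero {K L : Type*} [Field K]
    [LieRing L] [LieAlgebra K L]
    {s : L} (hs : (LieAlgebra.ad K L s).IsSemisimple) {x : L} (hx : ⁅s, ⁅s, x⁆⁆ = 0) :
    ⁅s, x⁆ = 0 := by
  have h := hs.isFinitelySemisimple.genEigenspace_eq_eigenspace 0 (k := (2 : ℕ)) (by norm_num)
  have h2 : x ∈ (LieAlgebra.ad K L s).genEigenspace 0 (2 : ℕ) := by
    rw [Module.End.mem_genEigenspace_nat]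
    simp [pow_two, hx]
  rw [h] at h2
  simpa using h2

/-- The centralizer of an element, as a Lie subalgebra. -/
def lieCentralizer (K : Type*) {L : Type*} [Field K]
    [LieRing L] [LieAlgebra K L] (s : L) : LieSubalgebra K L where
  __ := LinearMap.ker (LieAlgebra.ad K L s)
  lie_mem' := by
    intro x y hx hy
    have hx' : ⁅s, x⁆ = 0 := hx
    have hy' : ⁅s, y⁆ = 0 := hy
    change ⁅s, ⁅x, y⁆⁆ = 0
    rw [leibniz_lie, hx', hy', zero_lie, lie_zero, add_zero]

theorem mem_lieCentralizer {K L : Type*} [Field K]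
    [LieRing L] [LieAlgebra K L] {s x : L} : x ∈ lieCentralizer K s ↔ ⁅s, x⁆ = 0 := Iff.rfl

/-- A semisimple element lies in some Cartan subalgebra. -/
theorem exists_isCartanSubalgebra_mem {K L : Type*} [Field K] [Infinite K]
    [LieRing L] [LieAlgebra K L] [FiniteDimensional K L]
    {s : L} (hs : (LieAlgebra.ad K L s).IsSemisimple) :
    ∃ H : LieSubalgebra K L, H.IsCartanSubalgebra ∧ s ∈ H := by
  set Z := lieCentralizer K s with hZ
  obtain ⟨z, hz⟩ := LieAlgebra.exists_isCartanSubalgebra_engel K Z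
  set C := LieSubalgebra.engel K z
  have hsZ : s ∈ Z := by simp [hZ, mem_lieCentralizer]
  have hsC : (⟨s, hsZ⟩ : Z) ∈ C := by
    rw [← hz.self_normalizing, LieSubalgebra.mem_normalizer_iff]
    intro y hy
    have : ⁅(⟨s, hsZ⟩ : Z), y⁆ = 0 := Subtype.ext (mem_lieCentralizer.mp y.2)
    rw [this]
    exact zero_mem _
  have hsH : s ∈ C.map Z.incl := ⟨⟨s, hsZ⟩, hsC, rfl⟩
  have hHZ : ∀ y ∈ C.map Z.incl, y ∈ Z := by
    rintro _ ⟨y, -, rfl⟩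
    exact y.2
  refine ⟨C.map Z.incl, ⟨?_, le_antisymm (fun x hx ↦ ?_) (LieSubalgebra.le_normalizer _)⟩, hsH⟩
  · have := hz.nilpotent
    exact (LieEquiv.nilpotent_iff_equiv_nilpotent
      (C.equivMapOfInjective Z.incl Subtype.val_injective)).mp this
  · rw [LieSubalgebra.mem_normalizer_iff] at hx
    have hxZ : x ∈ Z := by
      refine lie_eq_zero_of_lie_lie_eq_zero hs ?_
      rw [← lie_skew s x, lie_neg, neg_eq_zero]
      exact mem_lieCentralizer.mp (hHZ _ (hx s hsH))
    refine ⟨⟨x, hxZ⟩, ?_, rfl⟩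
    change _ ∈ C
    rw [← hz.self_normalizing, LieSubalgebra.mem_normalizer_iff]
    intro y hy
    obtain ⟨w, hw, hwy⟩ := hx y ⟨y, hy, rfl⟩
    have : w = ⁅(⟨x, hxZ⟩ : Z), y⁆ := Subtype.ext hwy
    exact this ▸ hw

theorem eq_top_of_rootSpace_le {K L : Type*} [Field K] [LieRing L] [LieAlgebra K L]
    [FiniteDimensional K L] {H : LieSubalgebra K L} [H.IsCartanSubalgebra]
    [IsTriangularizable K H L] (S : LieSubalgebra K L) (hH : H ≤ S)
    (hS : ∀ i : H.root, ∀ x ∈ rootSpace H i.1, x ∈ S) : S = ⊤ := by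
  rw [eq_top_iff]
  intro x _
  have hx : x ∈ ⨆ χ : Weight K H L, (rootSpace H χ).toSubmodule := by
    rw [← LieSubmodule.iSup_toSubmodule, LieModule.iSup_genWeightSpace_eq_top']
    trivial
  suffices h : ⨆ χ : Weight K H L, (rootSpace H χ).toSubmodule ≤ S.toSubmodule from h hx
  refine iSup_le fun χ y hy ↦ ?_
  by_cases hχ : χ.IsZero
  · rw [hχ.eq] at hy
    have : y ∈ rootSpace H (0 : H → K) := hy
    rw [rootSpace_zero_eq] at this
    exact hH this
  · exact hS ⟨χ, by simpa using hχ⟩ y hy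

section RootSystem

variable {K L : Type*} [Field K] [CharZero K]
    [LieRing L] [LieAlgebra K L] [FiniteDimensional K L] [IsKilling K L]
    {H : LieSubalgebra K L} [H.IsCartanSubalgebra] [IsTriangularizable K H L]

/-- Root spaces are one-dimensional, so a subalgebra meeting one non-trivially contains it. -/
theorem rootSpace_le_of_mem {α : Weight K H L} (hα : α.IsNonZero) {x : L}
    (hx : x ∈ rootSpace H α) (x_ne0 : x ≠ 0) {S : LieSubalgebra K L} (hxS : x ∈ S) :
    ∀ y ∈ rootSpace H α, y ∈ S := by
  intro y hy
  obtain ⟨k, hk⟩ := (finrank_eq_one_iff_of_nonzero' (⟨x, hx⟩ : rootSpace H α)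
    (by simpa [Subtype.ext_iff] using x_ne0)).mp (finrank_rootSpace_eq_one _ hα) ⟨y, hy⟩
  have hk' : k • x = y := congrArg Subtype.val hk
  exact hk' ▸ S.smul_mem k hxS

/-- If `γ = α + β` then the bracket of the root spaces of `α` and `β` is that of `γ`, so a
subalgebra containing the first two contains the third. -/
theorem rootSpace_le_of_eq_add {α β γ : Weight K H L} (hα : α.IsNonZero) (hγ : γ.IsNonZero)
    (h : (γ : H → K) = α + β) {S : LieSubalgebra K L}
    (hαS : ∀ x ∈ rootSpace H α, x ∈ S) (hβS : ∀ x ∈ rootSpace H β, x ∈ S) :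
    ∀ x ∈ rootSpace H γ, x ∈ S := by
  obtain ⟨y, hy, y_ne0⟩ := (chainTop α β).exists_ne_zero
  obtain ⟨h, e, f, isSl2, he, hf⟩ := exists_isSl2Triple_of_weight_isNonZero hα
  obtain rfl := isSl2.h_eq_coroot hα he hf
  have prim : isSl2.HasPrimitiveVectorWith y (chainLength α β : K) :=
    have := lie_mem_genWeightSpace_of_mem_genWeightSpace he hy
    ⟨y_ne0, (chainLength_smul _ _ hy).symm, by rwa [genWeightSpace_add_chainTop _ _ hα] at this⟩
  have hq : 1 ≤ chainTopCoeff α β := by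
    have := (rootSpace_zsmul_add_ne_bot_iff (α := α) (β := β) hα 1).mp (by
      rw [one_smul, ← h]; exact γ.2)
    exact_mod_cast this.1
  obtain ⟨n, hn⟩ := Nat.exists_eq_add_of_le' hq
  have hle := chainTopCoeff_le_chainLength α β
  have h1 := prim.lie_e_pow_succ_toEnd_f n
  have h2 := prim.pow_toEnd_f_ne_zero_of_eq_nat rfl (i := n) (by omega)
  have m1 := toEnd_pow_apply_mem hf hy n
  have m2 := toEnd_pow_apply_mem hf hy (n + 1)
  rw [show (n • (-α) + chainTop α β : H → K) = γ by
    rw [h, coe_chainTop', hn, add_smul]; simp; abel] at m1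
  rw [show ((n + 1) • (-α) + chainTop α β : H → K) = β by
    rw [coe_chainTop', hn]; simp] at m2
  have hmem : ((LieModule.toEnd K L L f) ^ n) y ∈ S := by
    have h3 := S.lie_mem (hαS _ he) (hβS _ m2)
    rw [h1] at h3
    refine (S.toSubmodule.smul_mem_iff ?_).mp h3
    have : ((chainLength α β : K) - n) ≠ 0 := by
      rw [sub_ne_zero]; norm_cast; omega
    exact mul_ne_zero (by exact_mod_cast n.succ_ne_zero) this
  exact rootSpace_le_of_mem hγ m1 h2 hmem

/-- A subalgebra containing the root spaces of the simple roots and of their negatives contains all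
root spaces. -/
theorem rootSpace_le_of_support (b : (rootSystem H).Base) {S : LieSubalgebra K L}
    (hS : ∀ i ∈ b.support, (∀ x ∈ rootSpace H i.1, x ∈ S) ∧
      ∀ x ∈ rootSpace H (-i.1), x ∈ S) (i : H.root) :
    (∀ x ∈ rootSpace H i.1, x ∈ S) ∧ ∀ x ∈ rootSpace H (-i.1), x ∈ S := by
  induction i using b.induction_add with
  | h₀ i hi =>
    have : (((rootSystem H).reflectionPerm i i).1 : H → K) = -i.1 := by
      have h := (rootSystem H).root_reflectionPerm i i
      rw [RootPairing.reflection_apply_self, rootSystem_root_apply, rootSystem_root_apply] at h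
      ext x
      exact LinearMap.congr_fun h x
    rw [this, neg_neg]
    exact hi.symm
  | h₁ i hi => exact hS i hi
  | h₂ i j k hk hi hj =>
    have nz (i : H.root) : i.1.IsNonZero := (Finset.mem_filter.mp i.2).2
    have hk' : (k.1 : H → K) = j.1 + i.1 := by
      simp only [rootSystem_root_apply] at hk
      ext x
      rw [add_comm]
      exact LinearMap.congr_fun hk x
    refine ⟨rootSpace_le_of_eq_add (nz j) (nz k) hk' (hS j hj).1 hi.1, ?_⟩
    have := rootSpace_le_of_eq_add (nz j).neg (nz k).neg (α := -j.1) (β := -i.1) (γ := -k.1) (S := S)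
      (by simp [hk']; abel)
    simp only [Weight.coe_neg] at this
    exact this (hS j hj).2 hi.2

theorem span_coroot_image_support (b : (rootSystem H).Base) :
    Submodule.span K (Set.range fun i : b.support ↦ coroot i.1.1) = ⊤ := by
  rw [← RootPairing.IsRootSystem.span_coroot_eq_top (P := rootSystem H)]
  change _ = (rootSystem H).corootSpan K
  rw [← b.span_coroot_support, Set.image_eq_range]
  rfl

theorem span_coroot_support_eq (b : (rootSystem H).Base) :
    Submodule.span K (Set.range fun i : b.support ↦ (coroot i.1.1 : L)) = H.toSubmodule := by
  have := congrArg (Submodule.map H.toSubmodule.subtype) (span_coroot_image_support b)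
  rw [Submodule.map_span, ← Set.range_comp, Submodule.map_top, Submodule.range_subtype] at this
  exact this

/-- A Chevalley basis exists for any splitting Cartan subalgebra. -/
theorem exists_basis : ∃ (b : (rootSystem H).Base), Nonempty (LieAlgebra.Basis b.support H) := by
  obtain ⟨b⟩ := (rootSystem H).nonempty_base
  have nz (i : H.root) : i.1.IsNonZero := (Finset.mem_filter.mp i.2).2
  choose h e f sl2 he hf using fun i : b.support ↦ exists_isSl2Triple_of_weight_isNonZero (nz i)
  have hh (i : b.support) : h i = coroot i.1.1 := (sl2 i).h_eq_coroot (nz i) (he i) (hf i)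
  have hspan : Submodule.span K (Set.range h) = H.toSubmodule := by
    rw [funext hh]; exact span_coroot_support_eq b
  have hA (i j : b.support) : i.1.1 (coroot j.1.1) = (b.cartanMatrix i j : K) := by
    rw [← rootSystem_pairing_apply, ← b.algebraMap_cartanMatrixIn_apply ℤ]
    rfl
  have hhh (i j : b.support) : ⁅h i, h j⁆ = 0 := by
    rw [hh, hh, ← LieSubalgebra.coe_bracket, trivial_lie_zero, ZeroMemClass.coe_zero]
  refine ⟨b, ⟨{
    A := b.cartanMatrix
    h := h
    e := e
    f := f
    cartan_eq_lieSpan := ?_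
    span_ef := ?_
    linInd := ?_
    nondegen := b.cartanMatrix_nondegenerate
    sl2 := sl2
    lie_h_h := hhh
    lie_h_e := fun i j ↦ ?_
    lie_h_f := fun i j ↦ ?_
    lie_e_f_ne := fun i j hij ↦ ?_ }⟩⟩
  · rw [← LieSubalgebra.toSubmodule_inj, ← hspan]
    refine (LieSubalgebra.coe_lieSpan_eq_span_of_forall_lie_eq_zero ?_).symm
    rintro _ ⟨i, rfl⟩ _ ⟨j, rfl⟩
    exact hhh i j
  · set S := LieSubalgebra.lieSpan K L (Set.range e ∪ Set.range f)
    have heS (i) : e i ∈ S := LieSubalgebra.subset_lieSpan (.inl ⟨i, rfl⟩)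
    have hfS (i) : f i ∈ S := LieSubalgebra.subset_lieSpan (.inr ⟨i, rfl⟩)
    refine eq_top_of_rootSpace_le (H := H) S ?_ fun i ↦ (rootSpace_le_of_support b ?_ i).1
    · change H.toSubmodule ≤ S.toSubmodule
      rw [← hspan, Submodule.span_le]
      rintro _ ⟨i, rfl⟩
      rw [← (sl2 i).lie_e_f]
      exact S.lie_mem (heS i) (hfS i)
    · intro i hi
      refine ⟨rootSpace_le_of_mem (nz i) (he ⟨i, hi⟩) (sl2 _).e_ne_zero (heS _), ?_⟩
      have := rootSpace_le_of_mem (α := -i.1) (nz i).neg (x := f ⟨i, hi⟩)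
        (by simpa using hf ⟨i, hi⟩) (sl2 _).f_ne_zero (hfS _)
      simpa using this
  · rw [funext hh]
    exact b.linearIndepOn_coroot.map' H.toSubmodule.subtype (Submodule.ker_subtype _)
  · rw [hh, ← Int.cast_smul_eq_zsmul K, ← hA]
    exact lie_eq_smul_of_mem_rootSpace (he i) _
  · rw [hh, ← Int.cast_smul_eq_zsmul K, Int.cast_neg, ← hA]
    exact lie_eq_smul_of_mem_rootSpace (hf i) _
  · have hmem := lie_mem_genWeightSpace_of_mem_genWeightSpace (he i) (hf j)
    by_contra hne
    let χ : Weight K H L := ⟨i.1.1 + -j.1.1, fun h ↦ hne (by rwa [h, LieSubmodule.mem_bot] at hmem)⟩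
    have hχ : (χ : H → K) = i.1.1 + -j.1.1 := rfl
    by_cases h0 : χ.IsZero
    · refine hij (Subtype.ext (Subtype.ext (DFunLike.coe_injective ?_)))
      rw [h0.eq] at hχ
      exact (add_neg_eq_zero.mp hχ.symm)
    · refine b.sub_notMem_range_root i.2 j.2
        ⟨⟨χ, Finset.mem_filter.mpr ⟨Finset.mem_univ _, h0⟩⟩, ?_⟩
      ext x
      simp [rootSystem_root_apply, hχ, sub_eq_add_neg]

end RootSystem

end

theorem exists_automorphism_neg_of_semisimple
    (K L : Type*) [Field K] [IsAlgClosed K] [CharZero K]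
    [LieRing L] [LieAlgebra K L] [FiniteDimensional K L] [LieAlgebra.IsSimple K L]
    (s : L) (hs : (LieAlgebra.ad K L s).IsSemisimple) :
    ∃ α : L ≃ₗ⁅K⁆ L, α s = -s := by
  obtain ⟨H, hH, hsH⟩ := exists_isCartanSubalgebra_mem hs
  obtain ⟨_, ⟨b⟩⟩ := exists_basis (K := K) (L := L) (H := H)
  obtain ⟨α, hα⟩ := b.exists_equiv_apply_eq_neg
  exact ⟨α, hα s hsH⟩
end
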